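/- Corollary 4.2: Suppose the symmetric, measurable, uniformly elliptic coefficients a^{ij} on ℝ^{d+1} are independent of z' = (t,x'), i.e. a^{ij}(t,x',x'') = a^{ij}(s,y',x'') for all t, s, x', y', x''. Let δ ∈ (0,1), let f satisfy [f]_{t,δ/2;ℝ^{d+1}_0} + [f]_{x',δ;ℝ^{d+1}_0} < ∞, and let u be a bounded classical solution of u_t − a^{ij}D_{ij}u = f in ℝ^{d+1}_0 := (−∞,0)×ℝ^d. Then there is a constant N depending only on d, q, δ, ν such that [∂_t u]_{t,δ/2;ℝ^{d+1}_0} + [∂_t u]_{x',δ;ℝ^{d+1}_0} + max_{i,j≤q} ( [D_i D_j u]_{t,δ/2;ℝ^{d+1}_0} + [D_i D_j u]_{x',δ;ℝ^{d+1}_0} ) ≤ N ( [f]_{t,δ/2;ℝ^{d+1}_0} + [f]_{x',δ;ℝ^{d+1}_0} ). -/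

import Mathlib

open MeasureTheory Metric Set Filter

noncomputable section

/-- Spatial first-order partial derivative `D_i`. -/
def sd {d : ℕ} (i : Fin d) (v : EuclideanSpace ℝ (Fin d) → ℝ)
    (x : EuclideanSpace ℝ (Fin d)) : ℝ :=
  fderiv ℝ v x (EuclideanSpace.single i 1)

/-- Spatial second-order partial derivative `D_i D_j`. -/
def sd2 {d : ℕ} (i j : Fin d) (v : EuclideanSpace ℝ (Fin d) → ℝ)
    (x : EuclideanSpace ℝ (Fin d)) : ℝ :=
  sd i (fun y => sd j v y) x

/-- Time derivative `∂_t`. -/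
def td {d : ℕ} (u : ℝ → EuclideanSpace ℝ (Fin d) → ℝ) (t : ℝ)
    (x : EuclideanSpace ℝ (Fin d)) : ℝ :=
  deriv (fun s => u s x) t

/-- Parabolic cylinder `Q_ρ = (-ρ², 0) × B_ρ`. -/
def parQ (d : ℕ) (ρ : ℝ) : Set (ℝ × EuclideanSpace ℝ (Fin d)) :=
  Ioo (-(ρ ^ 2)) 0 ×ˢ ball (0 : EuclideanSpace ℝ (Fin d)) ρ

/-- The half space `ℝ^{d+1}_0 = (-∞, 0) × ℝ^d`. -/
def parNeg (d : ℕ) : Set (ℝ × EuclideanSpace ℝ (Fin d)) :=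
  Iio (0 : ℝ) ×ˢ (univ : Set (EuclideanSpace ℝ (Fin d)))

/-- Partial Hölder bound in the first `q` spatial coordinates `x'`. -/
def PHolderXPar (d q : ℕ) (δ : ℝ) (Q : Set (ℝ × EuclideanSpace ℝ (Fin d)))
    (g : ℝ → EuclideanSpace ℝ (Fin d) → ℝ) (K : ℝ) : Prop :=
  ∀ (t : ℝ) (x y : EuclideanSpace ℝ (Fin d)), (t, x) ∈ Q → (t, y) ∈ Q →
    (∀ i : Fin d, q ≤ (i : ℕ) → x i = y i) → |g t x - g t y| ≤ K * dist x y ^ δ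

/-- Full spatial Hölder bound. -/
def HolderXPar (d : ℕ) (δ : ℝ) (Q : Set (ℝ × EuclideanSpace ℝ (Fin d)))
    (g : ℝ → EuclideanSpace ℝ (Fin d) → ℝ) (K : ℝ) : Prop :=
  ∀ (t : ℝ) (x y : EuclideanSpace ℝ (Fin d)), (t, x) ∈ Q → (t, y) ∈ Q →
    |g t x - g t y| ≤ K * dist x y ^ δ

/-- Hölder bound in the time variable `t`, with exponent `γ`. -/
def HolderTPar (d : ℕ) (γ : ℝ) (Q : Set (ℝ × EuclideanSpace ℝ (Fin d)))
    (g : ℝ → EuclideanSpace ℝ (Fin d) → ℝ) (K : ℝ) : Prop :=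
  ∀ (t s : ℝ) (x : EuclideanSpace ℝ (Fin d)), (t, x) ∈ Q → (s, x) ∈ Q →
    |g t x - g s x| ≤ K * |t - s| ^ γ

/-- Classical regularity of parabolic solutions: `u`, `∂_t u`, `Du`, `D²u` exist and are
continuous on `Q`. -/
def ParClassical {d : ℕ} (Q : Set (ℝ × EuclideanSpace ℝ (Fin d)))
    (u : ℝ → EuclideanSpace ℝ (Fin d) → ℝ) : Prop :=
  (∀ z ∈ Q, DifferentiableAt ℝ (fun s => u s z.2) z.1) ∧
  (∀ z ∈ Q, ContDiffAt ℝ 2 (u z.1) z.2) ∧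
  ContinuousOn (fun z : ℝ × EuclideanSpace ℝ (Fin d) => u z.1 z.2) Q ∧
  ContinuousOn (fun z : ℝ × EuclideanSpace ℝ (Fin d) => td u z.1 z.2) Q ∧
  (∀ i : Fin d,
    ContinuousOn (fun z : ℝ × EuclideanSpace ℝ (Fin d) => sd i (u z.1) z.2) Q) ∧
  (∀ i j : Fin d,
    ContinuousOn (fun z : ℝ × EuclideanSpace ℝ (Fin d) => sd2 i j (u z.1) z.2) Q)

/-- Uniform ellipticity with constant `ν` (parabolic, two-sided bound). -/
def UnifEllipticP (d : ℕ) (ν : ℝ)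
    (a : Fin d → Fin d → ℝ → EuclideanSpace ℝ (Fin d) → ℝ) : Prop :=
  ∀ (t : ℝ) (x : EuclideanSpace ℝ (Fin d)) (ξ : Fin d → ℝ),
    ν * ∑ i, ξ i ^ 2 ≤ ∑ i, ∑ j, a i j t x * ξ i * ξ j ∧
      ∑ i, ∑ j, a i j t x * ξ i * ξ j ≤ ν⁻¹ * ∑ i, ξ i ^ 2

/-! ### Linear algebra -/

lemma det_parab {E : Type*} [NormedAddCommGroup E] [InnerProductSpace ℝ E] [FiniteDimensional ℝ E]
    (c : ℝ) (y g : E) (H : E →L[ℝ] E) (T : ℝ × E →L[ℝ] ℝ × E)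
    (hT : ∀ τ ξ, T (τ, ξ) = (c * τ - inner ℝ y (τ • g + H ξ), τ • g + H ξ)) :
    T.det = c * LinearMap.det (H : E →ₗ[ℝ] E) := by
  have h : (T : ℝ × E →ₗ[ℝ] ℝ × E) =
      (LinearMap.transvection ((-((innerSL ℝ y : E →L[ℝ] ℝ) : E →ₗ[ℝ] ℝ)) ∘ₗ LinearMap.snd ℝ ℝ E)
        ((1 : ℝ), (0 : E))) ∘ₗ
      ((LinearMap.prodMap (c • LinearMap.id) LinearMap.id : ℝ × E →ₗ[ℝ] ℝ × E) ∘ₗ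
      ((LinearMap.transvection (LinearMap.fst ℝ ℝ E) ((0 : ℝ), g)) ∘ₗ
       (LinearMap.prodMap LinearMap.id (H : E →ₗ[ℝ] E)))) := by
    apply LinearMap.ext
    rintro ⟨τ, ξ⟩
    rw [ContinuousLinearMap.coe_coe, hT]
    simp [LinearMap.transvection.apply, add_comm, sub_eq_add_neg]
  rw [ContinuousLinearMap.det, h, LinearMap.det_comp, LinearMap.det_comp, LinearMap.det_comp,
    LinearMap.transvection.det, LinearMap.transvection.det, LinearMap.det_prodMap,
    LinearMap.det_prodMap]
  simp

open scoped MatrixOrder ComplexOrder in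
lemma psd_factor {d : ℕ} (M : Matrix (Fin d) (Fin d) ℝ) (hM : M.PosSemidef) :
    ∃ B : Matrix (Fin d) (Fin d) ℝ, M = B.conjTranspose * B :=
  CStarAlgebra.nonneg_iff_eq_star_mul_self.mp hM.nonneg

lemma trace_le_of_ellip {d : ℕ} {ν K : ℝ} (hν : 0 < ν) (A M : Matrix (Fin d) (Fin d) ℝ)
    (hA : ∀ ξ : Fin d → ℝ, ν * ∑ i, ξ i ^ 2 ≤ ∑ i, ∑ j, A i j * ξ i * ξ j)
    (hM : M.PosSemidef) (hK : ∑ i, ∑ j, A i j * M i j ≤ K) :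
    0 ≤ M.det ∧ M.det ≤ (K / ν) ^ d ∧ 0 ≤ ∑ i, ∑ j, A i j * M i j := by
  classical
  obtain ⟨B, rfl⟩ := psd_factor M hM
  set M := B.conjTranspose * B with hMdef
  have htr0 : ν * M.trace ≤ ∑ i, ∑ j, A i j * M i j := by
    have h1 : ∑ i, ∑ j, A i j * M i j = ∑ k, ∑ i, ∑ j, A i j * B k i * B k j := by
      have : ∀ i j, A i j * M i j = ∑ k, A i j * B k i * B k j := by
        intro i j
        simp [hMdef, Matrix.mul_apply, Finset.mul_sum, mul_assoc]
      simp_rw [this]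
      have h2 : ∀ i, ∑ j, ∑ k, A i j * B k i * B k j = ∑ k, ∑ j, A i j * B k i * B k j :=
        fun i => Finset.sum_comm
      simp_rw [h2]
      exact Finset.sum_comm
    have h2 : M.trace = ∑ k, ∑ i, B k i ^ 2 := by
      simp only [hMdef, Matrix.trace, Matrix.diag, Matrix.mul_apply, Matrix.conjTranspose_apply,
        star_trivial]
      rw [Finset.sum_comm]
      simp [sq]
    rw [h1, h2, Finset.mul_sum]
    exact Finset.sum_le_sum fun k _ => hA (B k)
  have htr : ν * M.trace ≤ K := htr0.trans hK
  have hpos : 0 ≤ ∑ i, ∑ j, A i j * M i j :=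
    le_trans (mul_nonneg hν.le hM.trace_nonneg) htr0
  have hH := hM.isHermitian
  have hd := hH.det_eq_prod_eigenvalues
  have ht := hH.trace_eq_sum_eigenvalues
  simp only [RCLike.ofReal_real_eq_id, id] at hd ht
  have hnn := hM.eigenvalues_nonneg
  refine ⟨hM.det_nonneg, ?_, hpos⟩
  have hle : M.trace ≤ K / ν := by rw [le_div_iff₀ hν]; linarith
  calc M.det = ∏ i, hH.eigenvalues i := hd
    _ ≤ ∏ i : Fin d, (K / ν) := by
        refine Finset.prod_le_prod (fun i _ => hnn i) (fun i _ => le_trans ?_ hle)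
        rw [ht]
        exact Finset.single_le_sum (f := hH.eigenvalues) (fun j _ => hnn j) (Finset.mem_univ i)
    _ = _ := by simp [div_pow]

/-- determinant bound for a symmetric nonnegative bilinear form on Euclidean space -/
lemma det_form_le {d : ℕ} {ν K : ℝ} (hν : 0 < ν) (A : Matrix (Fin d) (Fin d) ℝ)
    (hA : ∀ ξ : Fin d → ℝ, ν * ∑ i, ξ i ^ 2 ≤ ∑ i, ∑ j, A i j * ξ i * ξ j)
    (B : EuclideanSpace ℝ (Fin d) →L[ℝ] EuclideanSpace ℝ (Fin d) →L[ℝ] ℝ)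
    (hs : ∀ x y, B x y = B y x) (hp : ∀ x, 0 ≤ B x x)
    (hK : ∑ i, ∑ j, A i j * B (EuclideanSpace.single i 1) (EuclideanSpace.single j 1) ≤ K)
    (H : EuclideanSpace ℝ (Fin d) →L[ℝ] EuclideanSpace ℝ (Fin d))
    (hH : ∀ x y, inner ℝ (H x) y = B x y) :
    0 ≤ LinearMap.det (H : EuclideanSpace ℝ (Fin d) →ₗ[ℝ] EuclideanSpace ℝ (Fin d)) ∧
    LinearMap.det (H : EuclideanSpace ℝ (Fin d) →ₗ[ℝ] EuclideanSpace ℝ (Fin d)) ≤ (K / ν) ^ d ∧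
    0 ≤ ∑ i, ∑ j, A i j * B (EuclideanSpace.single i 1) (EuclideanSpace.single j 1) := by
  set b := EuclideanSpace.basisFun (Fin d) ℝ
  set M : Matrix (Fin d) (Fin d) ℝ := Matrix.of fun i j =>
    B (EuclideanSpace.single i 1) (EuclideanSpace.single j 1)
  have hdet : LinearMap.det (H : EuclideanSpace ℝ (Fin d) →ₗ[ℝ] EuclideanSpace ℝ (Fin d))
      = M.det := by
    rw [← LinearMap.det_toMatrix b.toBasis]
    congr 1
    ext i j
    simp only [LinearMap.toMatrix_apply, M, Matrix.of_apply]
    rw [hs, ← hH]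
    simp [b, EuclideanSpace.inner_single_right]
  rw [hdet]
  refine trace_le_of_ellip hν A M hA ?_ hK
  refine Matrix.PosSemidef.of_dotProduct_mulVec_nonneg ?_ ?_
  · ext i j
    simp [M, hs]
  · intro x
    have : star x ⬝ᵥ M.mulVec x = B (WithLp.toLp 2 x) (WithLp.toLp 2 x) := by
      have hx : WithLp.toLp 2 x = ∑ i, x i • (EuclideanSpace.single i (1:ℝ)) := by
        ext k
        simp [Finset.sum_apply, Pi.single_apply]
      rw [hx]
      simp only [map_sum, map_smul, FunLike.coe_sum, FunLike.coe_smul, Finset.sum_apply, Pi.smul_apply, smul_eq_mul, dotProduct, Matrix.mulVec, M, Matrix.of_apply,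
        Pi.star_apply, star_trivial]
      simp_rw [Finset.mul_sum]
      rw [Finset.sum_comm]
      refine Finset.sum_congr rfl fun i _ => Finset.sum_congr rfl fun j _ => ?_
      ring
    rw [this]
    exact hp _

/-! ### Contact points -/

lemma contact_pt {d : ℕ} (w : ℝ → EuclideanSpace ℝ (Fin d) → ℝ) (L : EuclideanSpace ℝ (Fin d) → ℝ)
    {t₀ r : ℝ} {x₀ : EuclideanSpace ℝ (Fin d)} (ht₀ : t₀ < 0) (hr : 0 < r)
    (hc : ContinuousOn (fun z : ℝ × EuclideanSpace ℝ (Fin d) => w z.1 z.2) (parNeg d))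
    (hL : Continuous L)
    (hlat : ∀ t ∈ Icc (t₀ - r ^ 2) t₀, ∀ x ∈ sphere x₀ r, L x < w t x)
    (hbot : ∀ x ∈ closedBall x₀ r, L x < w (t₀ - r ^ 2) x)
    (htop : w t₀ x₀ ≤ L x₀) :
    ∃ t₁ ∈ Ioc (t₀ - r ^ 2) t₀, ∃ x₁ ∈ ball x₀ r, w t₁ x₁ = L x₁ ∧
      IsLocalMin (fun x => w t₁ x - L x) x₁ ∧ ∀ t ∈ Ico (t₀ - r ^ 2) t₁, w t₁ x₁ ≤ w t x₁ := by
  have hr2 : 0 < r ^ 2 := by positivity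
  set Q : Set (ℝ × EuclideanSpace ℝ (Fin d)) := Icc (t₀ - r ^ 2) t₀ ×ˢ closedBall x₀ r with hQ
  have hQc : IsCompact Q := isCompact_Icc.prod (isCompact_closedBall x₀ r)
  have hQsub : Q ⊆ parNeg d := fun z hz => ⟨lt_of_le_of_lt hz.1.2 ht₀, mem_univ _⟩
  set g : ℝ × EuclideanSpace ℝ (Fin d) → ℝ := fun z => w z.1 z.2 - L z.2 with hg
  have hgc : ContinuousOn g (parNeg d) := hc.sub (hL.comp continuous_snd).continuousOn
  have hScl : IsClosed (Q ∩ g ⁻¹' Iic 0) :=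
    (hgc.mono hQsub).preimage_isClosed_of_isClosed hQc.isClosed isClosed_Iic
  have hSc : IsCompact (Q ∩ g ⁻¹' Iic 0) := hQc.of_isClosed_subset hScl inter_subset_left
  have hne : (Q ∩ g ⁻¹' Iic 0).Nonempty := by
    refine ⟨(t₀, x₀), ⟨⟨by linarith, le_rfl⟩, mem_closedBall_self hr.le⟩, ?_⟩
    simp [hg, htop]
  obtain ⟨⟨t₁, x₁⟩, ⟨⟨ht₁, hx₁⟩, hg₁⟩, hmin⟩ := hSc.exists_isMinOn hne continuous_fst.continuousOn
  simp only at ht₁ hx₁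
  have hg₁' : w t₁ x₁ ≤ L x₁ := by simpa [hg] using hg₁
  have hmin' : ∀ t ∈ Ico (t₀ - r ^ 2) t₁, ∀ x ∈ closedBall x₀ r, L x < w t x := by
    intro t ht x hx
    by_contra hcon
    have : (t, x) ∈ Q ∩ g ⁻¹' Iic 0 :=
      ⟨⟨⟨ht.1, ht.2.le.trans ht₁.2⟩, hx⟩, by simpa [hg] using hcon⟩
    have := hmin this
    simp only [mem_ofPred_eq] at this
    linarith [ht.2]
  have ht₁0 : t₁ < 0 := lt_of_le_of_lt ht₁.2 ht₀
  have hlt : t₀ - r ^ 2 < t₁ := by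
    rcases ht₁.1.lt_or_eq with h | h
    · exact h
    · exfalso
      have := hbot x₁ hx₁
      rw [h] at this
      linarith
  have hball : x₁ ∈ ball x₀ r := by
    rcases (mem_closedBall.1 hx₁).lt_or_eq with h | h
    · exact h
    · have := hlat t₁ ht₁ x₁ h
      linarith
  have hlim : ∀ x ∈ closedBall x₀ r, L x ≤ w t₁ x := by
    intro x hx
    have hcx : Tendsto (fun t => w t x) (nhdsWithin t₁ (Iio t₁)) (nhds (w t₁ x)) := by
      have h1 : ContinuousAt (fun t => w t x) t₁ := by
        have h2 : ContinuousAt (fun z : ℝ × EuclideanSpace ℝ (Fin d) => w z.1 z.2) (t₁, x) :=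
          hc.continuousAt ((isOpen_Iio.prod isOpen_univ).mem_nhds ⟨ht₁0, mem_univ _⟩)
        exact ContinuousAt.comp (f := fun t : ℝ => (t, x)) (x := t₁) h2 (by fun_prop)
      exact h1.tendsto.mono_left nhdsWithin_le_nhds
    refine ge_of_tendsto hcx ?_
    filter_upwards [Ioo_mem_nhdsLT hlt] with t ht
    exact (hmin' t ⟨ht.1.le, ht.2⟩ x hx).le
  have heq : w t₁ x₁ = L x₁ := le_antisymm hg₁' (hlim x₁ hx₁)
  refine ⟨t₁, ⟨hlt, ht₁.2⟩, x₁, hball, heq, ?_, ?_⟩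
  · filter_upwards [isOpen_ball.mem_nhds hball] with x hx
    have := hlim x (ball_subset_closedBall hx)
    linarith
  · intro t ht
    rw [heq]
    exact (hmin' t ht x₁ hx₁).le

/-- second-order condition at a local minimum -/
lemma second_deriv_nonneg {E : Type*} [NormedAddCommGroup E] [NormedSpace ℝ E] (g : E → ℝ)
    (g1 : E → E →L[ℝ] ℝ) (g2 : E →L[ℝ] E →L[ℝ] ℝ) (x : E)
    (h1 : ∀ y, HasFDerivAt g (g1 y) y) (h2 : HasFDerivAt g1 g2 x) (hm : IsLocalMin g x) :
    g1 x = 0 ∧ ∀ ξ, 0 ≤ g2 ξ ξ := by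
  have h0 : g1 x = 0 := hm.hasFDerivAt_eq_zero (h1 x)
  refine ⟨h0, fun ξ => ?_⟩
  by_contra hneg
  push Not at hneg
  have hl : ∀ s : ℝ, HasDerivAt (fun s : ℝ => x + s • ξ) ξ s := by
    intro s
    simpa using ((hasDerivAt_id s).smul_const ξ).const_add x
  have hd1 : ∀ s : ℝ, HasDerivAt (fun s : ℝ => g (x + s • ξ)) (g1 (x + s • ξ) ξ) s := fun s =>
    (h1 _).comp_hasDerivAt s (hl s)
  have hd2 : HasDerivAt (fun s : ℝ => g1 (x + s • ξ) ξ) (g2 ξ ξ) 0 := by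
    have h3 : HasFDerivAt g1 g2 (x + (0 : ℝ) • ξ) := by simpa using h2
    have h4 : HasDerivAt (fun s : ℝ => g1 (x + s • ξ)) (g2 ξ) 0 :=
      h3.comp_hasDerivAt (0 : ℝ) (hl 0)
    simpa using h4.clm_apply (hasDerivAt_const (0 : ℝ) ξ)
  have hderiv : deriv (fun s : ℝ => g (x + s • ξ)) = fun s => g1 (x + s • ξ) ξ :=
    funext fun s => (hd1 s).deriv
  have hmin0 : IsLocalMin (fun s : ℝ => g (x + s • ξ)) 0 := by
    have hc : ContinuousAt (fun s : ℝ => x + s • ξ) 0 := by fun_prop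
    have : Tendsto (fun s : ℝ => x + s • ξ) (nhds 0) (nhds x) := by simpa using hc.tendsto
    have := this.eventually hm
    filter_upwards [this] with s hs
    simpa using hs
  have hlim : Tendsto (fun s : ℝ => s⁻¹ * g1 (x + s • ξ) ξ) (nhdsWithin 0 (Ioi 0))
      (nhds (g2 ξ ξ)) := by
    have := hd2.tendsto_slope_zero_right
    simpa [h0] using this
  have hev : ∀ᶠ s : ℝ in nhdsWithin 0 (Ioi 0), g1 (x + s • ξ) ξ < 0 := by
    filter_upwards [hlim.eventually (gt_mem_nhds hneg), self_mem_nhdsWithin] with s hs hs0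
    have : 0 < s⁻¹ := inv_pos.2 hs0
    by_contra hcon
    push Not at hcon
    exact absurd hs (not_lt.2 (mul_nonneg this.le hcon))
  obtain ⟨b, hb, hb'⟩ := (mem_nhdsGT_iff_exists_Ioo_subset).1 hev
  obtain ⟨c, hc, hcm⟩ : ∃ c ∈ Ioo 0 b, g (x + (0:ℝ) • ξ) ≤ g (x + c • ξ) := by
    have h5 : ∀ᶠ s : ℝ in nhdsWithin 0 (Ioi 0), g (x + (0:ℝ) • ξ) ≤ g (x + s • ξ) :=
      nhdsWithin_le_nhds hmin0
    obtain ⟨c, hc⟩ := (h5.and (Ioo_mem_nhdsGT hb)).exists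
    exact ⟨c, hc.2, hc.1⟩
  obtain ⟨e, he, hee⟩ := exists_hasDerivAt_eq_slope (fun s : ℝ => g (x + s • ξ)) _ hc.1
    (fun s _ => (hd1 s).continuousAt.continuousWithinAt) (fun s _ => hd1 s)
  have hlt : g1 (x + e • ξ) ξ < 0 := hb' ⟨he.1, he.2.trans hc.2⟩
  rw [hee] at hlt
  have := div_nonneg (sub_nonneg.2 hcm) (sub_nonneg.2 hc.1.le)
  linarith

/-! ### ABP-type measure estimate -/

lemma clm_tag (E F : Type*) [NormedAddCommGroup E] [NormedSpace ℝ E] [NormedAddCommGroup F]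
    [NormedSpace ℝ F] : IsTopologicalAddGroup (E →L[ℝ] F) := by
  infer_instance

lemma clm_csm (E F : Type*) [NormedAddCommGroup E] [NormedSpace ℝ E] [NormedAddCommGroup F]
    [NormedSpace ℝ F] : ContinuousSMul ℝ (E →L[ℝ] F) := by
  infer_instance

instance clm2_tag (d : ℕ) : IsTopologicalAddGroup
    (EuclideanSpace ℝ (Fin d) →L[ℝ] EuclideanSpace ℝ (Fin d) →L[ℝ] ℝ) := clm_tag _ _

instance clm2_csm (d : ℕ) : ContinuousSMul ℝ
    (EuclideanSpace ℝ (Fin d) →L[ℝ] EuclideanSpace ℝ (Fin d) →L[ℝ] ℝ) := clm_csm _ _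

lemma clm_ca (E F : Type*) [NormedAddCommGroup E] [NormedSpace ℝ E] [NormedAddCommGroup F]
    [NormedSpace ℝ F] : ContinuousAdd (E →L[ℝ] F) := by
  infer_instance

lemma clm_cs (E F : Type*) [NormedAddCommGroup E] [NormedSpace ℝ E] [NormedAddCommGroup F]
    [NormedSpace ℝ F] : ContinuousSub (E →L[ℝ] F) := by
  infer_instance

instance clm2_ca (d : ℕ) : ContinuousAdd
    (EuclideanSpace ℝ (Fin d) →L[ℝ] EuclideanSpace ℝ (Fin d) →L[ℝ] ℝ) := clm_ca _ _

instance clm2_cs (d : ℕ) : ContinuousSub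
    (EuclideanSpace ℝ (Fin d) →L[ℝ] EuclideanSpace ℝ (Fin d) →L[ℝ] ℝ) := clm_cs _ _

/-- Riesz map on Euclidean space. -/
def rieszJ (d : ℕ) : (EuclideanSpace ℝ (Fin d) →L[ℝ] ℝ) →L[ℝ] EuclideanSpace ℝ (Fin d) :=
  ∑ i, (ContinuousLinearMap.apply ℝ ℝ (EuclideanSpace.single i (1 : ℝ))).smulRight
    (EuclideanSpace.single i (1 : ℝ))

lemma eucl_sum_single {d : ℕ} (y : EuclideanSpace ℝ (Fin d)) :
    y = ∑ i, y i • (EuclideanSpace.single i (1:ℝ)) := by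
  ext k
  simp [Finset.sum_apply, Pi.single_apply]

lemma inner_rieszJ {d : ℕ} (l : EuclideanSpace ℝ (Fin d) →L[ℝ] ℝ) (y : EuclideanSpace ℝ (Fin d)) :
    inner ℝ (rieszJ d l) y = l y := by
  conv_rhs => rw [eucl_sum_single y]
  simp [rieszJ, sum_inner, inner_smul_left, EuclideanSpace.inner_single_left, mul_comm]

/-- inner product as a bilinear map -/
def ipB (d : ℕ) : EuclideanSpace ℝ (Fin d) →L[ℝ] EuclideanSpace ℝ (Fin d) →L[ℝ] ℝ :=
  innerSL ℝ

lemma ipB_apply {d : ℕ} (x y : EuclideanSpace ℝ (Fin d)) : ipB d x y = inner ℝ x y := rfl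

/-- joint derivative assembled from partial ones -/
abbrev jointD {d : ℕ} {F : Type*} [NormedAddCommGroup F] [NormedSpace ℝ F] (ft : F)
    (fx : EuclideanSpace ℝ (Fin d) →L[ℝ] F) : ℝ × EuclideanSpace ℝ (Fin d) →L[ℝ] F :=
  (ContinuousLinearMap.toSpanSingleton ℝ ft).coprod fx

lemma parNeg_open (d : ℕ) : IsOpen (parNeg d) := isOpen_Iio.prod isOpen_univ

instance volHaar (d : ℕ) :
    (volume : Measure (ℝ × EuclideanSpace ℝ (Fin d))).IsAddHaarMeasure := by
  rw [Measure.volume_eq_prod]; infer_instance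

lemma abp_det {d : ℕ} {ν K : ℝ} (hν : 0 < ν) (hK : 0 ≤ K)
    (a : Fin d → Fin d → ℝ → EuclideanSpace ℝ (Fin d) → ℝ) (ha : UnifEllipticP d ν a)
    (w wt : ℝ → EuclideanSpace ℝ (Fin d) → ℝ)
    (W1 Wt : ℝ → EuclideanSpace ℝ (Fin d) → EuclideanSpace ℝ (Fin d) →L[ℝ] ℝ)
    (W2 : ℝ → EuclideanSpace ℝ (Fin d) →
      EuclideanSpace ℝ (Fin d) →L[ℝ] EuclideanSpace ℝ (Fin d) →L[ℝ] ℝ)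
    (x₀ : EuclideanSpace ℝ (Fin d))
    (hw : ∀ z ∈ parNeg d, HasFDerivAt (fun z : ℝ × EuclideanSpace ℝ (Fin d) => w z.1 z.2)
      (jointD (wt z.1 z.2) (W1 z.1 z.2)) z)
    (hW : ∀ z ∈ parNeg d, HasFDerivAt (fun z : ℝ × EuclideanSpace ℝ (Fin d) => W1 z.1 z.2)
      (jointD (Wt z.1 z.2) (W2 z.1 z.2)) z)
    (hsym : ∀ z ∈ parNeg d, ∀ ξ η, W2 z.1 z.2 ξ η = W2 z.1 z.2 η ξ)
    (Γ : Set (ℝ × EuclideanSpace ℝ (Fin d))) (hΓm : MeasurableSet Γ) (hΓ : Γ ⊆ parNeg d)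
    (hΓt : ∀ z ∈ Γ, wt z.1 z.2 ≤ 0) (hΓx : ∀ z ∈ Γ, ∀ ξ, 0 ≤ W2 z.1 z.2 ξ ξ)
    (hae : ∀ᵐ z ∂(volume.restrict Γ), - wt z.1 z.2 + ∑ i, ∑ j, a i j z.1 z.2 *
      W2 z.1 z.2 (EuclideanSpace.single i 1) (EuclideanSpace.single j 1) ≤ K) :
    volume ((fun z : ℝ × EuclideanSpace ℝ (Fin d) =>
      (w z.1 z.2 - W1 z.1 z.2 (z.2 - x₀), rieszJ d (W1 z.1 z.2))) '' Γ) ≤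
      ENNReal.ofReal (K * (K / ν) ^ d) * volume Γ := by
  set T : ℝ × EuclideanSpace ℝ (Fin d) → ℝ × EuclideanSpace ℝ (Fin d) →L[ℝ]
      ℝ × EuclideanSpace ℝ (Fin d) := fun z =>
    (jointD (wt z.1 z.2) (W1 z.1 z.2) -
      ((W1 z.1 z.2).comp (ContinuousLinearMap.snd ℝ ℝ (EuclideanSpace ℝ (Fin d))) +
        (jointD (Wt z.1 z.2) (W2 z.1 z.2)).flip (z.2 - x₀))).prod
      ((rieszJ d).comp (jointD (Wt z.1 z.2) (W2 z.1 z.2))) with hTdef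
  have hder : ∀ z ∈ parNeg d, HasFDerivAt (fun z : ℝ × EuclideanSpace ℝ (Fin d) =>
      (w z.1 z.2 - W1 z.1 z.2 (z.2 - x₀), rieszJ d (W1 z.1 z.2))) (T z) z := by
    intro z hz
    refine HasFDerivAt.prodMk ((hw z hz).sub ?_) ((rieszJ d).hasFDerivAt.comp z (hW z hz))
    exact (hW z hz).clm_apply (hasFDerivAt_snd.sub_const x₀)
  have hdet : ∀ z, (T z).det = wt z.1 z.2 *
      LinearMap.det (((rieszJ d).comp (W2 z.1 z.2) : EuclideanSpace ℝ (Fin d) →L[ℝ]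
        EuclideanSpace ℝ (Fin d)) : EuclideanSpace ℝ (Fin d) →ₗ[ℝ] EuclideanSpace ℝ (Fin d)) := by
    intro z
    refine det_parab (wt z.1 z.2) (z.2 - x₀) (rieszJ d (Wt z.1 z.2))
      ((rieszJ d).comp (W2 z.1 z.2)) (T z) ?_
    intro τ ξ
    have h1 : ∀ l, inner ℝ (z.2 - x₀) (rieszJ d l) = l (z.2 - x₀) := fun l => by
      rw [real_inner_comm, inner_rieszJ]
    simp only [hTdef, inner_add_right, inner_smul_right, h1, ContinuousLinearMap.comp_apply]
    simp [map_add]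
    ring
  refine (addHaar_image_le_lintegral_abs_det_fderiv volume hΓm
    (fun z hz => (hder z (hΓ hz)).hasFDerivWithinAt)).trans ?_
  rw [← setLIntegral_const]
  refine lintegral_mono_ae ?_
  filter_upwards [hae, ae_restrict_mem hΓm] with z hz hzΓ
  refine ENNReal.ofReal_le_ofReal ?_
  have hwt := hΓt z hzΓ
  have hB := fun K' hK' => det_form_le (K := K') hν (Matrix.of fun i j => a i j z.1 z.2)
    (fun ξ => (ha z.1 z.2 ξ).1) (W2 z.1 z.2) (hsym z (hΓ hzΓ)) (hΓx z hzΓ) hK'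
    ((rieszJ d).comp (W2 z.1 z.2)) (fun x y => inner_rieszJ _ _)
  obtain ⟨-, -, h3⟩ := hB _ le_rfl
  simp only [Matrix.of_apply] at h3
  obtain ⟨h1, h2, -⟩ := hB K (by simp only [Matrix.of_apply]; linarith)
  rw [hdet, abs_mul, abs_of_nonpos hwt, abs_of_nonneg h1]
  exact mul_le_mul (by linarith) h2 h1 hK

lemma sum_diag_le {d : ℕ} {ν : ℝ}
    (a : Fin d → Fin d → ℝ → EuclideanSpace ℝ (Fin d) → ℝ) (ha : UnifEllipticP d ν a) (t x) :
    ∑ i, a i i t x ≤ d / ν := by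
  have h : ∀ i, a i i t x ≤ ν⁻¹ := by
    intro i
    have := (ha t x (Pi.single i 1)).2
    simpa [Pi.single_apply] using this
  calc ∑ i, a i i t x ≤ ∑ i : Fin d, ν⁻¹ := Finset.sum_le_sum fun i _ => h i
    _ = _ := by simp [div_eq_mul_inv]

/-- the constant in the ABP estimate -/
def abpC (d : ℕ) (ν : ℝ) : ℝ := 6 + 10 * d / ν

lemma abp_main {d : ℕ} {ν : ℝ} (hν : 0 < ν)
    (a : Fin d → Fin d → ℝ → EuclideanSpace ℝ (Fin d) → ℝ) (ha : UnifEllipticP d ν a)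
    (v vt : ℝ → EuclideanSpace ℝ (Fin d) → ℝ)
    (D1 Dt : ℝ → EuclideanSpace ℝ (Fin d) → EuclideanSpace ℝ (Fin d) →L[ℝ] ℝ)
    (D2 : ℝ → EuclideanSpace ℝ (Fin d) →
      EuclideanSpace ℝ (Fin d) →L[ℝ] EuclideanSpace ℝ (Fin d) →L[ℝ] ℝ)
    (hv : ∀ z ∈ parNeg d, HasFDerivAt (fun z : ℝ × EuclideanSpace ℝ (Fin d) => v z.1 z.2)
      (jointD (vt z.1 z.2) (D1 z.1 z.2)) z)
    (hD : ∀ z ∈ parNeg d, HasFDerivAt (fun z : ℝ × EuclideanSpace ℝ (Fin d) => D1 z.1 z.2)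
      (jointD (Dt z.1 z.2) (D2 z.1 z.2)) z)
    (hvt : ContinuousOn (fun z : ℝ × EuclideanSpace ℝ (Fin d) => vt z.1 z.2) (parNeg d))
    (hD2 : ContinuousOn (fun z : ℝ × EuclideanSpace ℝ (Fin d) => D2 z.1 z.2) (parNeg d))
    (hpos : ∀ z ∈ parNeg d, 0 ≤ v z.1 z.2)
    {t₀ r ε : ℝ} {x₀ : EuclideanSpace ℝ (Fin d)} (ht₀ : t₀ < 0) (hr : 0 < r) (hε : 0 < ε)
    (h0 : v t₀ x₀ ≤ ε)
    (hae : ∀ᵐ z ∂(volume.restrict (parNeg d)), - (ε / r ^ 2) ≤ vt z.1 z.2 - ∑ i, ∑ j, a i j z.1 z.2 *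
      D2 z.1 z.2 (EuclideanSpace.single i 1) (EuclideanSpace.single j 1)) :
    ENNReal.ofReal (ν ^ d / abpC d ν ^ (d + 1) * r ^ (d + 2)) *
        volume (ball (0 : EuclideanSpace ℝ (Fin d)) 1) ≤
      volume {z : ℝ × EuclideanSpace ℝ (Fin d) | z ∈ Icc (t₀ - r ^ 2) t₀ ×ˢ closedBall x₀ r ∧
        v z.1 z.2 ≤ 4 * ε} := by
  have hr2 : 0 < r ^ 2 := by positivity
  set c : ℝ := 5 * ε / r ^ 2 with hcdef
  have hc : 0 < c := by positivity
  have hcr : c * r ^ 2 = 5 * ε := by rw [hcdef]; field_simp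
  set w : ℝ → EuclideanSpace ℝ (Fin d) → ℝ := fun t x => v t x + c * (‖x - x₀‖ ^ 2 + (t₀ - t))
    with hw
  set wt : ℝ → EuclideanSpace ℝ (Fin d) → ℝ := fun t x => vt t x - c with hwt
  set W1 : ℝ → EuclideanSpace ℝ (Fin d) → EuclideanSpace ℝ (Fin d) →L[ℝ] ℝ := fun t x =>
    D1 t x + (2 * c) • ipB d (x - x₀) with hW1
  set W2 : ℝ → EuclideanSpace ℝ (Fin d) →
      EuclideanSpace ℝ (Fin d) →L[ℝ] EuclideanSpace ℝ (Fin d) →L[ℝ] ℝ := fun t x =>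
    D2 t x + (2 * c) • ipB d with hW2
  have hwd : ∀ z ∈ parNeg d, HasFDerivAt (fun z : ℝ × EuclideanSpace ℝ (Fin d) => w z.1 z.2)
      (jointD (wt z.1 z.2) (W1 z.1 z.2)) z := by
    intro z hz
    have h1 : HasFDerivAt (fun z : ℝ × EuclideanSpace ℝ (Fin d) => ‖z.2 - x₀‖ ^ 2) _ z :=
      HasFDerivAt.norm_sq (hasFDerivAt_snd.sub_const x₀)
    have h2 : HasFDerivAt (fun z : ℝ × EuclideanSpace ℝ (Fin d) => t₀ - z.1) _ z :=
      (ContinuousLinearMap.fst ℝ ℝ (EuclideanSpace ℝ (Fin d))).hasFDerivAt.const_sub t₀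
    have h3 := (hv z hz).add ((h1.add h2).const_mul c)
    refine h3.congr_fderiv ?_
    apply ContinuousLinearMap.ext
    rintro ⟨τ, ξ⟩
    simp [hwt, hW1, ipB_apply]; ring
  have hWd : ∀ z ∈ parNeg d, HasFDerivAt (fun z : ℝ × EuclideanSpace ℝ (Fin d) => W1 z.1 z.2)
      (jointD (Dt z.1 z.2) (W2 z.1 z.2)) z := by
    intro z hz
    have h1 : HasFDerivAt (fun z : ℝ × EuclideanSpace ℝ (Fin d) => ipB d (z.2 - x₀)) _ z :=
      (ipB d).hasFDerivAt.comp z (hasFDerivAt_snd.sub_const x₀)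
    have h3 := (hD z hz).add (h1.const_smul (2 * c))
    refine h3.congr_fderiv ?_
    apply ContinuousLinearMap.ext
    rintro ⟨τ, ξ⟩
    simp [hW2]; abel
  -- slices
  have hslice : ∀ t < (0:ℝ), ∀ x, HasFDerivAt (w t) (W1 t x) x := by
    intro t ht x
    have h1 := (hwd (t, x) ⟨ht, mem_univ _⟩).comp x (hasFDerivAt_prodMk_right t x)
    refine h1.congr_fderiv ?_
    ext y; simp
  have hslice2 : ∀ t < (0:ℝ), ∀ x, HasFDerivAt (W1 t) (W2 t x) x := by
    intro t ht x
    have h1 := (hWd (t, x) ⟨ht, mem_univ _⟩).comp x (hasFDerivAt_prodMk_right t x)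
    refine h1.congr_fderiv ?_
    ext y; simp
  have hslicet : ∀ t < (0:ℝ), ∀ x, HasDerivAt (fun s => w s x) (wt t x) t := by
    intro t ht x
    have h1 := (hwd (t, x) ⟨ht, mem_univ _⟩).comp_hasDerivAt t
      ((hasDerivAt_id t).prodMk (hasDerivAt_const t x))
    refine HasDerivAt.congr_deriv h1 ?_
    simp
  have hsym : ∀ z ∈ parNeg d, ∀ ξ η, W2 z.1 z.2 ξ η = W2 z.1 z.2 η ξ := by
    intro z hz ξ η
    exact second_derivative_symmetric (fun y => hslice z.1 hz.1 y) (hslice2 z.1 hz.1 z.2) ξ η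
  set Q : Set (ℝ × EuclideanSpace ℝ (Fin d)) := Icc (t₀ - r ^ 2) t₀ ×ˢ closedBall x₀ r with hQ
  have hQcl : IsClosed Q := isClosed_Icc.prod isClosed_closedBall
  have hQsub : Q ⊆ parNeg d := fun z hz => ⟨lt_of_le_of_lt hz.1.2 ht₀, mem_univ _⟩
  have hvc : ContinuousOn (fun z : ℝ × EuclideanSpace ℝ (Fin d) => v z.1 z.2) (parNeg d) :=
    fun z hz => (hv z hz).continuousAt.continuousWithinAt
  have hwc : ContinuousOn (fun z : ℝ × EuclideanSpace ℝ (Fin d) => w z.1 z.2) (parNeg d) :=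
    fun z hz => (hwd z hz).continuousAt.continuousWithinAt
  set Γ : Set (ℝ × EuclideanSpace ℝ (Fin d)) :=
    (Q ∩ (fun z : ℝ × EuclideanSpace ℝ (Fin d) => v z.1 z.2) ⁻¹' Iic (4 * ε)) ∩
    ((Q ∩ (fun z : ℝ × EuclideanSpace ℝ (Fin d) => vt z.1 z.2) ⁻¹' Iic c) ∩
    (Q ∩ (fun z : ℝ × EuclideanSpace ℝ (Fin d) => W2 z.1 z.2) ⁻¹' {B | ∀ ξ, 0 ≤ B ξ ξ})) with hΓdef
  have hΓcl : IsClosed Γ := by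
    refine IsClosed.inter ?_ (IsClosed.inter ?_ ?_)
    · exact (hvc.mono hQsub).preimage_isClosed_of_isClosed hQcl isClosed_Iic
    · exact (hvt.mono hQsub).preimage_isClosed_of_isClosed hQcl isClosed_Iic
    · refine ContinuousOn.preimage_isClosed_of_isClosed ?_ hQcl ?_
      · have hca : Continuous fun B : EuclideanSpace ℝ (Fin d) →L[ℝ]
            EuclideanSpace ℝ (Fin d) →L[ℝ] ℝ => B + (2 * c) • ipB d :=
          (continuous_id (X := EuclideanSpace ℝ (Fin d) →L[ℝ]
            EuclideanSpace ℝ (Fin d) →L[ℝ] ℝ)).add continuous_const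
        exact hca.comp_continuousOn (hD2.mono hQsub)
      · have : {B : EuclideanSpace ℝ (Fin d) →L[ℝ] EuclideanSpace ℝ (Fin d) →L[ℝ] ℝ |
            ∀ ξ, 0 ≤ B ξ ξ} = ⋂ ξ, {B | 0 ≤ B ξ ξ} := by ext; simp
        rw [this]
        refine isClosed_iInter fun ξ => isClosed_le continuous_const (by fun_prop)
  have hΓQ : Γ ⊆ Q := fun z hz => hz.1.1
  set K : ℝ := abpC d ν * (ε / r ^ 2) with hKdef
  have hCpos : 0 < abpC d ν := by unfold abpC; positivity
  have hK : 0 < K := by positivity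
  have hmeas := abp_det hν hK.le a ha w wt W1 Dt W2 x₀ hwd hWd hsym Γ hΓcl.measurableSet
    (hΓQ.trans hQsub) (fun z hz => by have := hz.2.1.2; simp only [mem_preimage, mem_Iic] at this;
                                      simp only [hwt]; linarith)
    (fun z hz => hz.2.2.2) (by
      have h1 := ae_mono (Measure.restrict_mono (hΓQ.trans hQsub) le_rfl) hae
      filter_upwards [h1] with z hz
      have hsum : ∑ i, ∑ j, a i j z.1 z.2 *
          W2 z.1 z.2 (EuclideanSpace.single i 1) (EuclideanSpace.single j 1) =
          ∑ i, ∑ j, a i j z.1 z.2 *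
          D2 z.1 z.2 (EuclideanSpace.single i 1) (EuclideanSpace.single j 1) +
          2 * c * ∑ i, a i i z.1 z.2 := by
        rw [Finset.mul_sum, ← Finset.sum_add_distrib]
        refine Finset.sum_congr rfl fun i _ => ?_
        have : ∀ j, a i j z.1 z.2 *
          W2 z.1 z.2 (EuclideanSpace.single i 1) (EuclideanSpace.single j 1) = a i j z.1 z.2 *
          D2 z.1 z.2 (EuclideanSpace.single i 1) (EuclideanSpace.single j 1) +
          if i = j then 2 * c * a i i z.1 z.2 else 0 := by
          intro j
          split_ifs with hij
          · subst hij
            simp [hW2, ipB_apply]; ring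
          · simp [hW2, ipB_apply, EuclideanSpace.inner_single_left, hij]
        simp_rw [this, Finset.sum_add_distrib]
        simp
      rw [hsum]
      have h2 := sum_diag_le a ha z.1 z.2
      have h3 : 2 * c * ∑ i, a i i z.1 z.2 ≤ 2 * c * (d / ν) :=
        mul_le_mul_of_nonneg_left h2 (by positivity)
      have h4 : K = ε / r ^ 2 + c + 2 * c * (d / ν) := by
        rw [hKdef, hcdef, abpC]; ring
      simp only [hwt]
      linarith)
  have hcover : Ioo (2 * ε) (3 * ε) ×ˢ ball (0 : EuclideanSpace ℝ (Fin d)) (ε / r) ⊆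
      (fun z : ℝ × EuclideanSpace ℝ (Fin d) =>
      (w z.1 z.2 - W1 z.1 z.2 (z.2 - x₀), rieszJ d (W1 z.1 z.2))) '' Γ := by
    rintro ⟨h, p⟩ ⟨hh, hp⟩
    simp only at hh hp
    have hp' : ‖p‖ < ε / r := by simpa using hp
    set L : EuclideanSpace ℝ (Fin d) → ℝ := fun x => inner ℝ p (x - x₀) + h with hL
    have hLb : ∀ x ∈ closedBall x₀ r, L x < 4 * ε := by
      intro x hx
      have h1 : inner ℝ p (x - x₀) ≤ ‖p‖ * ‖x - x₀‖ := real_inner_le_norm _ _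
      have h2 : ‖x - x₀‖ ≤ r := by simpa [dist_eq_norm] using hx
      have h3 : ‖p‖ * ‖x - x₀‖ ≤ (ε / r) * r :=
        mul_le_mul hp'.le h2 (norm_nonneg _) (by positivity)
      have h4 : (ε / r) * r = ε := by field_simp
      simp only [hL]
      linarith [hh.2]
    obtain ⟨t₁, ht₁, x₁, hx₁, heq, hmin, htmin⟩ := contact_pt w L ht₀ hr hwc
      (by simp only [hL]; fun_prop)
      (by
        intro t ht x hx
        have h1 := hLb x (sphere_subset_closedBall hx)
        have h2 : ‖x - x₀‖ = r := by simpa [dist_eq_norm] using hx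
        have h3 := hpos (t, x) ⟨lt_of_le_of_lt ht.2 ht₀, mem_univ _⟩
        have h4 : c * (‖x - x₀‖ ^ 2 + (t₀ - t)) ≥ c * r ^ 2 := by
          rw [h2]
          exact mul_le_mul_of_nonneg_left (by linarith [ht.2]) hc.le
        simp only [hw]
        simp only at h3
        linarith)
      (by
        intro x hx
        have h1 := hLb x hx
        have h3 := hpos (t₀ - r ^ 2, x) ⟨by simp only [mem_Iio]; linarith, mem_univ _⟩
        have h4 : c * (‖x - x₀‖ ^ 2 + (t₀ - (t₀ - r ^ 2))) ≥ c * r ^ 2 := by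
          exact mul_le_mul_of_nonneg_left (by linarith [sq_nonneg ‖x - x₀‖]) hc.le
        simp only [hw]
        simp only at h3
        linarith)
      (by simp [hw, hL]; linarith [hh.1])
    have ht₁0 : t₁ < 0 := lt_of_le_of_lt ht₁.2 ht₀
    have hLd : ∀ y, HasFDerivAt L (ipB d p) y := by
      intro y
      exact ((ipB d p).hasFDerivAt.comp y ((hasFDerivAt_id y).sub_const x₀)).add_const h
    obtain ⟨hg1, hg2⟩ := second_deriv_nonneg (fun x => w t₁ x - L x)
      (fun x => W1 t₁ x - ipB d p) (W2 t₁ x₁) x₁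
      (fun y => (hslice t₁ ht₁0 y).sub (hLd y)) ((hslice2 t₁ ht₁0 x₁).sub_const _) hmin
    have hgr : W1 t₁ x₁ = ipB d p := sub_eq_zero.1 hg1
    have hx₁' : x₁ ∈ closedBall x₀ r := ball_subset_closedBall hx₁
    have hzQ : (t₁, x₁) ∈ Q := ⟨⟨ht₁.1.le, ht₁.2⟩, hx₁'⟩
    refine ⟨(t₁, x₁), ⟨⟨hzQ, ?_⟩, ⟨hzQ, ?_⟩, ⟨hzQ, ?_⟩⟩, ?_⟩
    · have h1 := hLb x₁ hx₁'
      have h2 : 0 ≤ c * (‖x₁ - x₀‖ ^ 2 + (t₀ - t₁)) :=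
        mul_nonneg hc.le (by linarith [ht₁.2, sq_nonneg ‖x₁ - x₀‖])
      simp only [hw] at heq
      simp only [mem_preimage, mem_Iic]
      linarith
    · have h1 := hslicet t₁ ht₁0 x₁
      have h2 : wt t₁ x₁ ≤ 0 := by
        refine le_of_tendsto h1.tendsto_slope_zero_left ?_
        have h5 : Ioo (t₀ - r ^ 2 - t₁) 0 ∈ nhdsWithin (0 : ℝ) (Iio 0) :=
          Ioo_mem_nhdsLT (by linarith [ht₁.1])
        filter_upwards [h5] with s hs
        have h6 := htmin (t₁ + s) ⟨by linarith [hs.1], by linarith [hs.2]⟩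
        have h7 : s⁻¹ ≤ 0 := inv_nonpos.2 hs.2.le
        simp only [smul_eq_mul]
        exact mul_nonpos_of_nonpos_of_nonneg h7 (by linarith)
      simp only [hwt] at h2
      simp only [mem_preimage, mem_Iic]
      linarith
    · exact hg2
    · simp only [hgr]
      refine Prod.ext ?_ ?_
      · simp only [heq, hL, ipB_apply]; ring
      · simp only
        refine ext_inner_right ℝ fun y => ?_
        rw [inner_rieszJ, ipB_apply]
  have hfin := (measure_mono hcover).trans hmeas
  have hvol : volume (Ioo (2 * ε) (3 * ε) ×ˢ ball (0 : EuclideanSpace ℝ (Fin d)) (ε / r)) =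
      ENNReal.ofReal (ε * (ε / r) ^ d) * volume (ball (0 : EuclideanSpace ℝ (Fin d)) 1) := by
    rw [Measure.volume_eq_prod, Measure.prod_prod, Real.volume_Ioo,
      Measure.addHaar_ball_of_pos _ _ (by positivity), ENNReal.ofReal_mul hε.le]
    simp only [finrank_euclideanSpace, Fintype.card_fin, mul_assoc]
    congr 2; ring
  rw [hvol] at hfin
  have hKpos : 0 < K * (K / ν) ^ d := by positivity
  have hident : ε * (ε / r) ^ d =
      (K * (K / ν) ^ d) * (ν ^ d / abpC d ν ^ (d + 1) * r ^ (d + 2)) := by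
    rw [hKdef, div_pow, div_pow, mul_pow, div_pow, ← pow_mul]
    field_simp
    ring
  rw [hident, ENNReal.ofReal_mul hKpos.le, mul_assoc] at hfin
  have hfin2 := (ENNReal.mul_le_mul_iff_right (by simpa using hKpos) ENNReal.ofReal_ne_top).1 hfin
  refine hfin2.trans (measure_mono fun z hz => ⟨hz.1.1, hz.1.2⟩)

/-! ### The class of admissible functions -/

/-- Bounded classical functions on `parNeg d`, with their derivatives. -/
@[ext]
structure Fn (d : ℕ) where
  f : ℝ → EuclideanSpace ℝ (Fin d) → ℝ
  ft : ℝ → EuclideanSpace ℝ (Fin d) → ℝ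
  D1 : ℝ → EuclideanSpace ℝ (Fin d) → EuclideanSpace ℝ (Fin d) →L[ℝ] ℝ
  D2 : ℝ → EuclideanSpace ℝ (Fin d) →
      EuclideanSpace ℝ (Fin d) →L[ℝ] EuclideanSpace ℝ (Fin d) →L[ℝ] ℝ
  hft : ∀ t < 0, ∀ x, HasDerivAt (fun s => f s x) (ft t x) t
  hD1 : ∀ t < 0, ∀ x, HasFDerivAt (f t) (D1 t x) x
  hD2 : ∀ t < 0, ∀ x, HasFDerivAt (D1 t) (D2 t x) x
  cf : ContinuousOn (fun z : ℝ × EuclideanSpace ℝ (Fin d) => f z.1 z.2) (parNeg d)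
  cft : ContinuousOn (fun z : ℝ × EuclideanSpace ℝ (Fin d) => ft z.1 z.2) (parNeg d)
  cD1 : ContinuousOn (fun z : ℝ × EuclideanSpace ℝ (Fin d) => D1 z.1 z.2) (parNeg d)
  cD2 : ContinuousOn (fun z : ℝ × EuclideanSpace ℝ (Fin d) => D2 z.1 z.2) (parNeg d)
  bdd : ∃ M : ℝ, ∀ t < 0, ∀ x, |f t x| ≤ M

/-- admissible translation vectors: backwards in time -/
abbrev Vec (d : ℕ) := NNReal × EuclideanSpace ℝ (Fin d)

namespace Fn

variable {d : ℕ}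

/-- linear combination -/
def lin (α β : ℝ) (F G : Fn d) : Fn d where
  f := fun t x => α * F.f t x + β * G.f t x
  ft := fun t x => α * F.ft t x + β * G.ft t x
  D1 := fun t x => α • F.D1 t x + β • G.D1 t x
  D2 := fun t x => α • F.D2 t x + β • G.D2 t x
  hft := fun t ht x => ((F.hft t ht x).const_mul α).add ((G.hft t ht x).const_mul β)
  hD1 := fun t ht x => ((F.hD1 t ht x).const_mul α).add ((G.hD1 t ht x).const_mul β)
  hD2 := fun t ht x => ((F.hD2 t ht x).const_smul α).add ((G.hD2 t ht x).const_smul β)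
  cf := (continuousOn_const.mul F.cf).add (continuousOn_const.mul G.cf)
  cft := (continuousOn_const.mul F.cft).add (continuousOn_const.mul G.cft)
  cD1 := (F.cD1.const_smul α).add (G.cD1.const_smul β)
  cD2 := (F.cD2.const_smul α).add (G.cD2.const_smul β)
  bdd := by
    obtain ⟨M, hM⟩ := F.bdd
    obtain ⟨N, hN⟩ := G.bdd
    refine ⟨|α| * M + |β| * N, fun t ht x => ?_⟩
    refine (abs_add_le _ _).trans ?_
    rw [abs_mul, abs_mul]
    exact add_le_add (mul_le_mul_of_nonneg_left (hM t ht x) (abs_nonneg _))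
      (mul_le_mul_of_nonneg_left (hN t ht x) (abs_nonneg _))

lemma shift_lt {t : ℝ} (ht : t < 0) (s : NNReal) : t - s < 0 := by
  have := s.2
  have h : (0:ℝ) ≤ s := s.2
  linarith

lemma shift_cont {F : Type*} [TopologicalSpace F] {g : ℝ → EuclideanSpace ℝ (Fin d) → F}
    (hg : ContinuousOn (fun z : ℝ × EuclideanSpace ℝ (Fin d) => g z.1 z.2) (parNeg d)) (τ : Vec d) :
    ContinuousOn (fun z : ℝ × EuclideanSpace ℝ (Fin d) => g (z.1 - τ.1) (z.2 + τ.2)) (parNeg d) := by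
  have h : ContinuousOn (fun z : ℝ × EuclideanSpace ℝ (Fin d) => (z.1 - (τ.1 : ℝ), z.2 + τ.2))
      (parNeg d) := by fun_prop
  exact hg.comp h (fun z hz => ⟨shift_lt hz.1 τ.1, mem_univ _⟩)

/-- translation -/
def shift (τ : Vec d) (F : Fn d) : Fn d where
  f := fun t x => F.f (t - τ.1) (x + τ.2)
  ft := fun t x => F.ft (t - τ.1) (x + τ.2)
  D1 := fun t x => F.D1 (t - τ.1) (x + τ.2)
  D2 := fun t x => F.D2 (t - τ.1) (x + τ.2)
  hft := fun t ht x => (F.hft _ (shift_lt ht τ.1) (x + τ.2)).comp_sub_const t (τ.1 : ℝ)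
  hD1 := fun t ht x => (hasFDerivAt_comp_add_right τ.2).2 (F.hD1 _ (shift_lt ht τ.1) (x + τ.2))
  hD2 := fun t ht x => (hasFDerivAt_comp_add_right τ.2).2 (F.hD2 _ (shift_lt ht τ.1) (x + τ.2))
  cf := shift_cont F.cf τ
  cft := shift_cont F.cft τ
  cD1 := shift_cont F.cD1 τ
  cD2 := shift_cont F.cD2 τ
  bdd := by
    obtain ⟨M, hM⟩ := F.bdd
    exact ⟨M, fun t ht x => hM _ (shift_lt ht τ.1) _⟩

/-- difference -/
def dl (τ : Vec d) (F : Fn d) : Fn d := lin 1 (-1) F (shift τ F)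

lemma dl_f (τ : Vec d) (F : Fn d) (t x) :
    (dl τ F).f t x = F.f t x - F.f (t - τ.1) (x + τ.2) := by
  simp [dl, lin, shift, sub_eq_add_neg]

lemma dl_ft (τ : Vec d) (F : Fn d) (t x) :
    (dl τ F).ft t x = F.ft t x - F.ft (t - τ.1) (x + τ.2) := by
  simp [dl, lin, shift, sub_eq_add_neg]

lemma dl_D1 (τ : Vec d) (F : Fn d) (t x) :
    (dl τ F).D1 t x = F.D1 t x - F.D1 (t - τ.1) (x + τ.2) := by
  apply ContinuousLinearMap.ext; intro ξ
  simp only [dl, lin, shift, FunLike.coe_add, FunLike.coe_sub, FunLike.coe_smul, Pi.add_apply,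
    Pi.sub_apply, Pi.smul_apply, smul_eq_mul]
  ring

lemma dl_D2 (τ : Vec d) (F : Fn d) (t x) :
    (dl τ F).D2 t x = F.D2 t x - F.D2 (t - τ.1) (x + τ.2) := by
  apply ContinuousLinearMap.ext; intro ξ
  apply ContinuousLinearMap.ext; intro η
  simp only [dl, lin, shift, FunLike.coe_add, FunLike.coe_sub, FunLike.coe_smul, Pi.add_apply,
    Pi.sub_apply, Pi.smul_apply, smul_eq_mul]
  ring

lemma dl_comm (τ σ : Vec d) (F : Fn d) : dl τ (dl σ F) = dl σ (dl τ F) := by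
  have h1 : ∀ t : ℝ, t - τ.1 - σ.1 = t - σ.1 - τ.1 := fun t => by ring
  have h2 : ∀ x : EuclideanSpace ℝ (Fin d), x + τ.2 + σ.2 = x + σ.2 + τ.2 := fun x => by abel
  apply Fn.ext <;> funext t x
  · simp only [dl_f, h1, h2]; ring
  · simp only [dl_ft, h1, h2]; ring
  · simp only [dl_D1, h1, h2]; abel
  · simp only [dl_D2, h1, h2]; abel

/-- sup norm -/
def nrm (F : Fn d) : ℝ := sSup {y | ∃ t < (0:ℝ), ∃ x, y = |F.f t x|}

lemma le_nrm (F : Fn d) {t : ℝ} (ht : t < 0) (x) : |F.f t x| ≤ F.nrm := by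
  obtain ⟨M, hM⟩ := F.bdd
  refine le_csSup ⟨M, ?_⟩ ⟨t, ht, x, rfl⟩
  rintro y ⟨t, ht, x, rfl⟩
  exact hM t ht x

lemma nrm_le (F : Fn d) {B : ℝ} (h : ∀ t < (0:ℝ), ∀ x, |F.f t x| ≤ B) : F.nrm ≤ B := by
  refine csSup_le ⟨_, -1, by norm_num, 0, rfl⟩ ?_
  rintro y ⟨t, ht, x, rfl⟩
  exact h t ht x

lemma nrm_nonneg (F : Fn d) : 0 ≤ F.nrm :=
  (abs_nonneg _).trans (F.le_nrm (t := -1) (by norm_num) 0)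

lemma nrm_dl_le (τ : Vec d) (F : Fn d) : (dl τ F).nrm ≤ 2 * F.nrm := by
  refine nrm_le _ fun t ht x => ?_
  rw [dl_f]
  have h1 := F.le_nrm ht x
  have h2 := F.le_nrm (shift_lt ht τ.1) (x + τ.2)
  have := abs_sub (F.f t x) (F.f (t - τ.1) (x + τ.2))
  linarith

/-- the operator -/
def Lop (a : Fin d → Fin d → ℝ → EuclideanSpace ℝ (Fin d) → ℝ) (F : Fn d) (t : ℝ)
    (x : EuclideanSpace ℝ (Fin d)) : ℝ :=
  F.ft t x - ∑ i, ∑ j, a i j t x *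
    F.D2 t x (EuclideanSpace.single i 1) (EuclideanSpace.single j 1)

end Fn

/-- coefficients independent of the first `q` space variables and time -/
def CInv (d q : ℕ) (a : Fin d → Fin d → ℝ → EuclideanSpace ℝ (Fin d) → ℝ) : Prop :=
  ∀ i j (t s : ℝ) (x y : EuclideanSpace ℝ (Fin d)),
    (∀ k : Fin d, q ≤ (k : ℕ) → x k = y k) → a i j t x = a i j s y

/-- directions in the first `q` space variables -/
def Xp {d : ℕ} (q : ℕ) (h : EuclideanSpace ℝ (Fin d)) : Prop := ∀ k : Fin d, q ≤ (k : ℕ) → h k = 0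

namespace Fn
variable {d : ℕ}

lemma Lop_lin (a) (α β : ℝ) (F G : Fn d) (t x) :
    Lop a (lin α β F G) t x = α * Lop a F t x + β * Lop a G t x := by
  simp only [Lop, lin, FunLike.coe_add, FunLike.coe_smul, Pi.add_apply, Pi.smul_apply, smul_eq_mul,
    mul_add, mul_sub, Finset.sum_add_distrib, Finset.mul_sum]
  have h1 : ∀ (c : ℝ) (B : Fin d → Fin d → ℝ), ∑ i, ∑ j, a i j t x * (c * B i j) =
      ∑ i, ∑ j, c * (a i j t x * B i j) := fun c B =>
    Finset.sum_congr rfl fun i _ => Finset.sum_congr rfl fun j _ => by ring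
  rw [h1, h1]
  ring

lemma Lop_shift {q : ℕ} {a} (ha : CInv d q a) (τ : Vec d) (hτ : Xp q τ.2) (F : Fn d) (t x) :
    Lop a (shift τ F) t x = Lop a F (t - τ.1) (x + τ.2) := by
  simp only [Lop, shift]
  congr 1
  refine Finset.sum_congr rfl fun i _ => Finset.sum_congr rfl fun j _ => ?_
  rw [ha i j t (t - τ.1) x (x + τ.2)]
  intro k hk
  simp [hτ k hk]

/-- a.e. bound of the operator -/
def AEB (a : Fin d → Fin d → ℝ → EuclideanSpace ℝ (Fin d) → ℝ) (κ : ℝ) (F : Fn d) : Prop :=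
  ∀ᵐ z ∂((volume : Measure (ℝ × EuclideanSpace ℝ (Fin d))).restrict (parNeg d)),
    |Lop a F z.1 z.2| ≤ κ

lemma ae_parNeg_shift (τ : Vec d) {P : ℝ × EuclideanSpace ℝ (Fin d) → Prop}
    (h : ∀ᵐ z ∂((volume : Measure (ℝ × EuclideanSpace ℝ (Fin d))).restrict (parNeg d)), P z) :
    ∀ᵐ z ∂((volume : Measure (ℝ × EuclideanSpace ℝ (Fin d))).restrict (parNeg d)),
      P (z.1 - τ.1, z.2 + τ.2) := by
  have hm := (parNeg_open d).measurableSet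
  rw [ae_restrict_iff' hm] at h ⊢
  have h2 := (measurePreserving_add_right (volume : Measure (ℝ × EuclideanSpace ℝ (Fin d)))
    (-(τ.1 : ℝ), τ.2)).quasiMeasurePreserving.ae h
  filter_upwards [h2] with z hz hzn
  have h3 : z + (-(τ.1 : ℝ), τ.2) = (z.1 - τ.1, z.2 + τ.2) := by
    ext <;> simp [sub_eq_add_neg]
  rw [h3] at hz
  exact hz ⟨shift_lt hzn.1 τ.1, mem_univ _⟩

lemma AEB.mono {a} {κ κ' : ℝ} {F : Fn d} (h : AEB a κ F) (hk : κ ≤ κ') : AEB a κ' F := by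
  filter_upwards [h] with z hz using hz.trans hk

lemma AEB.lin {a} {κ κ' : ℝ} {F G : Fn d} (h : AEB a κ F) (h' : AEB a κ' G) (α β : ℝ) :
    AEB a (|α| * κ + |β| * κ') (Fn.lin α β F G) := by
  filter_upwards [h, h'] with z hz hz'
  rw [Lop_lin]
  refine (abs_add_le _ _).trans ?_
  rw [abs_mul, abs_mul]
  exact add_le_add (mul_le_mul_of_nonneg_left hz (abs_nonneg _))
      (mul_le_mul_of_nonneg_left hz' (abs_nonneg _))

lemma AEB.shift {q : ℕ} {a} (ha : CInv d q a) {κ : ℝ} {F : Fn d} (h : AEB a κ F) (τ : Vec d)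
    (hτ : Xp q τ.2) : AEB a κ (Fn.shift τ F) := by
  filter_upwards [ae_parNeg_shift τ h] with z hz
  rw [Lop_shift ha τ hτ]
  exact hz

lemma AEB.dl {q : ℕ} {a} (ha : CInv d q a) {κ : ℝ} {F : Fn d} (h : AEB a κ F) (τ : Vec d)
    (hτ : Xp q τ.2) : AEB a (2 * κ) (Fn.dl τ F) := by
  have := h.lin (h.shift ha τ hτ) 1 (-1)
  refine this.mono (le_of_eq ?_)
  simp; ring

end Fn

/-! ### Averages in time -/

section avg
variable {d : ℕ} {V : Type*} [NormedAddCommGroup V] [NormedSpace ℝ V] [CompleteSpace V]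

lemma avg_cont_glob (η : ℝ) (G : ℝ → EuclideanSpace ℝ (Fin d) → V)
    (hG : Continuous (fun z : ℝ × EuclideanSpace ℝ (Fin d) => G z.1 z.2)) :
    Continuous (fun z : ℝ × EuclideanSpace ℝ (Fin d) => ∫ s in (z.1 - η)..z.1, G s z.2) := by
  have hi : ∀ (x : EuclideanSpace ℝ (Fin d)) (a b : ℝ),
      IntervalIntegrable (fun s => G s x) volume a b := fun x a b =>
    (hG.comp (continuous_id.prodMk continuous_const)).intervalIntegrable a b
  have h1 : ∀ z : ℝ × EuclideanSpace ℝ (Fin d), ∫ s in (z.1 - η)..z.1, G s z.2 =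
      (∫ s in (0:ℝ)..z.1, G s z.2) - ∫ s in (0:ℝ)..(z.1 - η), G s z.2 := fun z => by
    rw [intervalIntegral.integral_interval_sub_left (hi _ _ _) (hi _ _ _)]
  simp_rw [h1]
  have hc : Continuous (Function.uncurry
      (fun (z : ℝ × EuclideanSpace ℝ (Fin d)) (s : ℝ) => G s z.2)) :=
    hG.comp (continuous_snd.prodMk (continuous_snd.comp continuous_fst))
  exact (intervalIntegral.continuous_parametric_intervalIntegral_of_continuous hc
      continuous_fst).sub
    (intervalIntegral.continuous_parametric_intervalIntegral_of_continuous hc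
      (continuous_fst.sub continuous_const))

lemma avg_deriv_t (η : ℝ) (G : ℝ → EuclideanSpace ℝ (Fin d) → V)
    (hG : Continuous (fun z : ℝ × EuclideanSpace ℝ (Fin d) => G z.1 z.2)) (t : ℝ)
    (x : EuclideanSpace ℝ (Fin d)) :
    HasDerivAt (fun t => ∫ s in (t - η)..t, G s x) (G t x - G (t - η) x) t := by
  have hc : Continuous (fun s => G s x) := hG.comp (continuous_id.prodMk continuous_const)
  have hi : ∀ a b : ℝ, IntervalIntegrable (fun s => G s x) volume a b := fun a b =>
    hc.intervalIntegrable a b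
  have h1 : ∀ t : ℝ, ∫ s in (t - η)..t, G s x =
      (∫ s in (0:ℝ)..t, G s x) - ∫ s in (0:ℝ)..(t - η), G s x := fun z => by
    rw [intervalIntegral.integral_interval_sub_left (hi _ _) (hi _ _)]
  simp_rw [h1]
  have h2 : ∀ t, HasDerivAt (fun t => ∫ s in (0:ℝ)..t, G s x) (G t x) t := fun t =>
    intervalIntegral.integral_hasDerivAt_right (hi _ _)
      (hc.stronglyMeasurableAtFilter _ _) hc.continuousAt
  exact (h2 t).sub ((h2 (t - η)).comp_sub_const t η)

lemma avg_deriv_x (η : ℝ) (G : ℝ → EuclideanSpace ℝ (Fin d) → V)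
    (G' : ℝ → EuclideanSpace ℝ (Fin d) → EuclideanSpace ℝ (Fin d) →L[ℝ] V)
    (hG : Continuous (fun z : ℝ × EuclideanSpace ℝ (Fin d) => G z.1 z.2))
    (hG' : Continuous (fun z : ℝ × EuclideanSpace ℝ (Fin d) => G' z.1 z.2))
    (hd : ∀ t x, HasFDerivAt (G t) (G' t x) x) (t : ℝ) (x : EuclideanSpace ℝ (Fin d)) :
    HasFDerivAt (fun x => ∫ s in (t - η)..t, G s x) (∫ s in (t - η)..t, G' s x) x := by
  have hc : ∀ x, Continuous (fun s => G s x) := fun x =>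
    hG.comp (continuous_id.prodMk continuous_const)
  have hc' : ∀ x, Continuous (fun s => G' s x) := fun x =>
    hG'.comp (continuous_id.prodMk continuous_const)
  obtain ⟨C, hC⟩ := ((isCompact_uIcc (a := t - η) (b := t)).prod
    (isCompact_closedBall x 1)).exists_bound_of_continuousOn hG'.continuousOn
  refine hasFDerivAt_integral_of_dominated_of_fderiv_le'' (F := fun x s => G s x)
    (F' := fun x s => G' s x) (bound := fun _ => C) (ball_mem_nhds x one_pos)
    (Eventually.of_forall fun y => (hc y).aestronglyMeasurable)
    ((hc x).intervalIntegrable _ _) (hc' x).aestronglyMeasurable ?_ intervalIntegrable_const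
    (Eventually.of_forall fun s y _ => hd s y)
  filter_upwards [ae_restrict_mem measurableSet_uIoc] with s hs y hy
  exact hC (s, y) ⟨uIoc_subset_uIcc hs, ball_subset_closedBall hy⟩

lemma avg_joint_glob (η : ℝ) (G : ℝ → EuclideanSpace ℝ (Fin d) → V)
    (G' : ℝ → EuclideanSpace ℝ (Fin d) → EuclideanSpace ℝ (Fin d) →L[ℝ] V)
    (hG : Continuous (fun z : ℝ × EuclideanSpace ℝ (Fin d) => G z.1 z.2))
    (hG' : Continuous (fun z : ℝ × EuclideanSpace ℝ (Fin d) => G' z.1 z.2))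
    (hd : ∀ t x, HasFDerivAt (G t) (G' t x) x) (z : ℝ × EuclideanSpace ℝ (Fin d)) :
    HasFDerivAt (fun z : ℝ × EuclideanSpace ℝ (Fin d) => ∫ s in (z.1 - η)..z.1, G s z.2)
      (jointD (G z.1 z.2 - G (z.1 - η) z.2) (∫ s in (z.1 - η)..z.1, G' s z.2)) z := by
  have := hasStrictFDerivAt_uncurry_coprod (𝕜 := ℝ) (u := z)
    (f := fun t (x : EuclideanSpace ℝ (Fin d)) => ∫ s in (t - η)..t, G s x)
    (f₁ := fun t x => ContinuousLinearMap.toSpanSingleton ℝ (G t x - G (t - η) x))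
    (f₂ := fun t x => ∫ s in (t - η)..t, G' s x)
    (Eventually.of_forall fun v => (avg_deriv_t η G hG v.1 v.2).hasFDerivAt)
    (Eventually.of_forall fun v => avg_deriv_x η G G' hG hG' hd v.1 v.2)
    (by
      apply Continuous.continuousAt
      have h1 : Continuous (fun z : ℝ × EuclideanSpace ℝ (Fin d) => G z.1 z.2 - G (z.1 - η) z.2) :=
        hG.sub (hG.comp ((continuous_fst.sub continuous_const).prodMk continuous_snd))
      exact (ContinuousLinearMap.toSpanSingletonLIE ℝ V).continuous.comp h1)
    (avg_cont_glob η G' hG').continuousAt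
  exact this.hasFDerivAt

/-- truncation in time -/
def trunc (c : ℝ) (G : ℝ → EuclideanSpace ℝ (Fin d) → V) : ℝ → EuclideanSpace ℝ (Fin d) → V :=
  fun t x => G (min t c) x

lemma trunc_cont {c : ℝ} (hc : c < 0) (G : ℝ → EuclideanSpace ℝ (Fin d) → V)
    (hG : ContinuousOn (fun z : ℝ × EuclideanSpace ℝ (Fin d) => G z.1 z.2) (parNeg d)) :
    Continuous (fun z : ℝ × EuclideanSpace ℝ (Fin d) => trunc c G z.1 z.2) := by
  have h : Continuous (fun z : ℝ × EuclideanSpace ℝ (Fin d) => (min z.1 c, z.2)) := by fun_prop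
  exact hG.comp_continuous h fun z => ⟨lt_of_le_of_lt (min_le_right _ _) hc, mem_univ _⟩

lemma trunc_int {c η : ℝ} (hη : 0 ≤ η) (G : ℝ → EuclideanSpace ℝ (Fin d) → V) {t : ℝ} (ht : t ≤ c)
    (x : EuclideanSpace ℝ (Fin d)) :
    ∫ s in (t - η)..t, trunc c G s x = ∫ s in (t - η)..t, G s x := by
  refine intervalIntegral.integral_congr fun s hs => ?_
  rw [uIcc_of_le (by linarith)] at hs
  simp [trunc, min_eq_left (hs.2.trans ht)]

lemma ev_lt {z : ℝ × EuclideanSpace ℝ (Fin d)} {c : ℝ} (h : z.1 < c) :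
    ∀ᶠ y : ℝ × EuclideanSpace ℝ (Fin d) in nhds z, y.1 ≤ c := by
  filter_upwards [continuous_fst.continuousAt.eventually (gt_mem_nhds h)] with y hy using hy.le

lemma avg_cont {η : ℝ} (hη : 0 ≤ η) (G : ℝ → EuclideanSpace ℝ (Fin d) → V)
    (hG : ContinuousOn (fun z : ℝ × EuclideanSpace ℝ (Fin d) => G z.1 z.2) (parNeg d)) :
    ContinuousOn (fun z : ℝ × EuclideanSpace ℝ (Fin d) => ∫ s in (z.1 - η)..z.1, G s z.2)
      (parNeg d) := by
  intro z hz
  have hz0 : z.1 < 0 := hz.1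
  have h1 := (avg_cont_glob η _ (trunc_cont (c := z.1 / 2) (by linarith) G hG)).continuousAt (x := z)
  refine (h1.congr ?_).continuousWithinAt
  filter_upwards [ev_lt (z := z) (c := z.1 / 2) (by linarith)] with y hy
  exact trunc_int hη G hy _

lemma avg_joint {η : ℝ} (hη : 0 ≤ η) (G : ℝ → EuclideanSpace ℝ (Fin d) → V)
    (G' : ℝ → EuclideanSpace ℝ (Fin d) → EuclideanSpace ℝ (Fin d) →L[ℝ] V)
    (hG : ContinuousOn (fun z : ℝ × EuclideanSpace ℝ (Fin d) => G z.1 z.2) (parNeg d))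
    (hG' : ContinuousOn (fun z : ℝ × EuclideanSpace ℝ (Fin d) => G' z.1 z.2) (parNeg d))
    (hd : ∀ t < 0, ∀ x, HasFDerivAt (G t) (G' t x) x) (z : ℝ × EuclideanSpace ℝ (Fin d))
    (hz : z ∈ parNeg d) :
    HasFDerivAt (fun z : ℝ × EuclideanSpace ℝ (Fin d) => ∫ s in (z.1 - η)..z.1, G s z.2)
      (jointD (G z.1 z.2 - G (z.1 - η) z.2) (∫ s in (z.1 - η)..z.1, G' s z.2)) z := by
  have hz0 : z.1 < 0 := hz.1
  have hc : z.1 / 2 < 0 := by linarith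
  have h1 := avg_joint_glob η (trunc (z.1 / 2) G) (trunc (z.1 / 2) G') (trunc_cont hc G hG)
    (trunc_cont hc G' hG') (fun t x => hd _ (lt_of_le_of_lt (min_le_right _ _) hc) x) z
  have h2 : HasFDerivAt (fun z : ℝ × EuclideanSpace ℝ (Fin d) => ∫ s in (z.1 - η)..z.1, G s z.2)
      _ z := h1.congr_of_eventuallyEq (by
    filter_upwards [ev_lt (z := z) (c := z.1 / 2) (by linarith)] with y hy
    exact (trunc_int hη G hy _).symm)
  refine h2.congr_fderiv ?_
  rw [trunc_int hη G' (by linarith)]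
  simp only [trunc]
  rw [min_eq_left (by linarith), min_eq_left (by linarith)]

end avg

/-! ### Measure estimate for averaged functions -/

namespace Fn
variable {d : ℕ}

lemma slice_cont {V : Type*} [TopologicalSpace V] {G : ℝ → EuclideanSpace ℝ (Fin d) → V}
    (hG : ContinuousOn (fun z : ℝ × EuclideanSpace ℝ (Fin d) => G z.1 z.2) (parNeg d))
    (x : EuclideanSpace ℝ (Fin d)) : ContinuousOn (fun s => G s x) (Iio 0) := by
  have h : ContinuousOn (fun s : ℝ => (s, x)) (Iio 0) := by fun_prop
  exact hG.comp h fun s hs => ⟨hs, mem_univ _⟩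

lemma slice_int {V : Type*} [NormedAddCommGroup V] {G : ℝ → EuclideanSpace ℝ (Fin d) → V}
    (hG : ContinuousOn (fun z : ℝ × EuclideanSpace ℝ (Fin d) => G z.1 z.2) (parNeg d))
    (x : EuclideanSpace ℝ (Fin d)) {t η : ℝ} (ht : t < 0) (hη : 0 ≤ η) :
    IntervalIntegrable (fun s => G s x) volume (t - η) t := by
  apply ContinuousOn.intervalIntegrable
  refine (slice_cont hG x).mono ?_
  rw [uIcc_of_le (by linarith)]
  exact fun s hs => lt_of_le_of_lt hs.2 ht

lemma avg_Lop {q : ℕ} {a} (ha : CInv d q a) (F : Fn d) {κ η : ℝ} (hη : 0 < η)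
    (h : AEB a κ F) :
    ∀ᵐ z ∂((volume : Measure (ℝ × EuclideanSpace ℝ (Fin d))).restrict (parNeg d)),
      |(F.f z.1 z.2 - F.f (z.1 - η) z.2) - ∑ i, ∑ j, a i j z.1 z.2 *
        (∫ s in (z.1 - η)..z.1, F.D2 s z.2) (EuclideanSpace.single i 1)
          (EuclideanSpace.single j 1)| ≤ κ * η := by
  have hm := (parNeg_open d).measurableSet
  unfold AEB at h
  rw [ae_restrict_iff' hm] at h ⊢
  have h1 : ∀ᵐ z ∂((volume : Measure (EuclideanSpace ℝ (Fin d))).prod (volume : Measure ℝ)),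
      z.swap ∈ parNeg d → |Lop a F z.swap.1 z.swap.2| ≤ κ :=
    (Measure.measurePreserving_swap (μ := (volume : Measure (EuclideanSpace ℝ (Fin d))))
      (ν := (volume : Measure ℝ))).quasiMeasurePreserving.ae h
  have h2 := Measure.ae_ae_of_ae_prod h1
  have h3 := (Measure.quasiMeasurePreserving_snd (μ := (volume : Measure ℝ))
    (ν := (volume : Measure (EuclideanSpace ℝ (Fin d))))).ae h2
  have h4 : ∀ᵐ z : ℝ × EuclideanSpace ℝ (Fin d), ∀ᵐ s : ℝ, s < 0 → |Lop a F s z.2| ≤ κ := by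
    filter_upwards [h3] with z hz
    filter_upwards [hz] with s hs hs0
    exact hs ⟨hs0, mem_univ _⟩
  filter_upwards [h4] with z hz hzn
  have ht : z.1 < 0 := hzn.1
  have hI2 := slice_int (G := F.D2) F.cD2 z.2 ht hη.le
  have e1 : F.f z.1 z.2 - F.f (z.1 - η) z.2 = ∫ s in (z.1 - η)..z.1, F.ft s z.2 := by
    refine (intervalIntegral.integral_eq_sub_of_hasDerivAt (f := fun s => F.f s z.2) ?_
      (slice_int F.cft z.2 ht hη.le)).symm
    intro s hs
    rw [uIcc_of_le (by linarith)] at hs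
    exact F.hft s (lt_of_le_of_lt hs.2 ht) z.2
  have hI3 : ∀ ξ : EuclideanSpace ℝ (Fin d), IntervalIntegrable (fun s => F.D2 s z.2 ξ) volume
      (z.1 - η) z.1 := fun ξ => by
    apply slice_int (G := fun s x => F.D2 s x ξ) _ z.2 ht hη.le
    exact F.cD2.clm_apply continuousOn_const
  have hI4 : ∀ ξ ζ : EuclideanSpace ℝ (Fin d), IntervalIntegrable (fun s => F.D2 s z.2 ξ ζ) volume
      (z.1 - η) z.1 := fun ξ ζ => by
    apply slice_int (G := fun s x => F.D2 s x ξ ζ) _ z.2 ht hη.le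
    exact (F.cD2.clm_apply continuousOn_const).clm_apply continuousOn_const
  have e2 : ∀ ξ ζ : EuclideanSpace ℝ (Fin d), (∫ s in (z.1 - η)..z.1, F.D2 s z.2) ξ ζ =
      ∫ s in (z.1 - η)..z.1, F.D2 s z.2 ξ ζ := fun ξ ζ => by
    rw [ContinuousLinearMap.intervalIntegral_apply hI2,
      ContinuousLinearMap.intervalIntegral_apply (hI3 ξ)]
  have e3 : (F.f z.1 z.2 - F.f (z.1 - η) z.2) - ∑ i, ∑ j, a i j z.1 z.2 *
        (∫ s in (z.1 - η)..z.1, F.D2 s z.2) (EuclideanSpace.single i 1)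
          (EuclideanSpace.single j 1) = ∫ s in (z.1 - η)..z.1, Lop a F s z.2 := by
    have e4 : (fun s => Lop a F s z.2) = fun s => F.ft s z.2 - ∑ i, ∑ j, a i j z.1 z.2 *
        F.D2 s z.2 (EuclideanSpace.single i 1) (EuclideanSpace.single j 1) := by
      funext s
      simp only [Lop]
      congr 1
      refine Finset.sum_congr rfl fun i _ => Finset.sum_congr rfl fun j _ => ?_
      rw [ha i j s z.1 z.2 z.2 fun _ _ => rfl]
    have hS : ∀ i, IntervalIntegrable (fun s => ∑ j, a i j z.1 z.2 *
        F.D2 s z.2 (EuclideanSpace.single i 1) (EuclideanSpace.single j 1)) volume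
        (z.1 - η) z.1 := fun i => by
      have := IntervalIntegrable.sum Finset.univ (fun j _ =>
        (hI4 (EuclideanSpace.single i 1) (EuclideanSpace.single j 1)).const_mul (a i j z.1 z.2))
      simpa only [Finset.sum_fn] using this
    rw [e4, intervalIntegral.integral_sub (slice_int F.cft z.2 ht hη.le), e1,
      intervalIntegral.integral_finsetSum]
    · congr 1
      refine Finset.sum_congr rfl fun i _ => ?_
      rw [intervalIntegral.integral_finsetSum]
      · refine Finset.sum_congr rfl fun j _ => ?_
        rw [intervalIntegral.integral_const_mul, e2]
      · exact fun j _ => (hI4 _ _).const_mul _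
    · exact fun i _ => hS i
    · have := IntervalIntegrable.sum Finset.univ (fun i _ => hS i)
      simpa only [Finset.sum_fn] using this
  rw [e3]
  have := intervalIntegral.norm_integral_le_of_norm_le_const_ae (a := z.1 - η) (b := z.1) (C := κ)
    (f := fun s => Lop a F s z.2) (by
      filter_upwards [hz] with s hs hs'
      rw [uIoc_of_le (by linarith)] at hs'
      exact hs (lt_of_le_of_lt hs'.2 ht))
  rwa [sub_sub_cancel, abs_of_pos hη, Real.norm_eq_abs] at this

lemma abp_avg {q : ℕ} {ν : ℝ} (hν : 0 < ν) {a} (hell : UnifEllipticP d ν a) (ha : CInv d q a)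
    (F : Fn d) {A η t₀ r ε : ℝ} {x₀ : EuclideanSpace ℝ (Fin d)} (hη : 0 < η)
    (ht₀ : t₀ < 0) (hr : 0 < r) (hε : 0 < ε)
    (hA : ∀ t < (0:ℝ), ∀ x, F.f t x ≤ A)
    (h0 : A - η⁻¹ * ∫ s in (t₀ - η)..t₀, F.f s x₀ ≤ ε) (h : AEB a (ε / r ^ 2) F) :
    ENNReal.ofReal (ν ^ d / abpC d ν ^ (d + 1) * r ^ (d + 2)) *
        volume (ball (0 : EuclideanSpace ℝ (Fin d)) 1) ≤
      volume {z : ℝ × EuclideanSpace ℝ (Fin d) | z ∈ Icc (t₀ - r ^ 2) t₀ ×ˢ closedBall x₀ r ∧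
        A - η⁻¹ * ∫ s in (z.1 - η)..z.1, F.f s z.2 ≤ 4 * ε} := by
  refine abp_main hν a hell (fun t x => A - η⁻¹ * ∫ s in (t - η)..t, F.f s x)
    (fun t x => -η⁻¹ * (F.f t x - F.f (t - η) x))
    (fun t x => (-η⁻¹) • ∫ s in (t - η)..t, F.D1 s x)
    (fun t x => (-η⁻¹) • (F.D1 t x - F.D1 (t - η) x))
    (fun t x => (-η⁻¹) • ∫ s in (t - η)..t, F.D2 s x) ?_ ?_ ?_ ?_ ?_ ht₀ hr hε h0 ?_
  · intro z hz
    have := ((avg_joint hη.le F.f F.D1 F.cf F.cD1 F.hD1 z hz).const_mul η⁻¹).const_sub A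
    refine this.congr_fderiv ?_
    apply ContinuousLinearMap.ext
    rintro ⟨τ, ξ⟩
    simp
    ring
  · intro z hz
    have := (avg_joint hη.le F.D1 F.D2 F.cD1 F.cD2 F.hD2 z hz).const_smul (-η⁻¹)
    refine this.congr_fderiv ?_
    apply ContinuousLinearMap.ext
    rintro ⟨τ, ξ⟩
    apply ContinuousLinearMap.ext
    intro ζ
    simp
    ring
  · exact continuousOn_const.mul (F.cf.sub (by
      have := shift_cont F.cf (⟨⟨η, hη.le⟩, 0⟩ : Vec d)
      simp only [add_zero] at this
      exact this))
  · exact (avg_cont hη.le F.D2 F.cD2).const_smul (-η⁻¹)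
  · intro z hz
    have hz0 : z.1 < 0 := hz.1
    have h1 : ∫ s in (z.1 - η)..z.1, F.f s z.2 ≤ ∫ s in (z.1 - η)..z.1, A :=
      intervalIntegral.integral_mono_on (by linarith) (slice_int F.cf z.2 hz0 hη.le)
        intervalIntegrable_const fun s hs => hA s (lt_of_le_of_lt hs.2 hz0) _
    rw [intervalIntegral.integral_const, sub_sub_cancel, smul_eq_mul] at h1
    have h2 := mul_le_mul_of_nonneg_left h1 (inv_pos.2 hη).le
    rw [← mul_assoc, inv_mul_cancel₀ hη.ne', one_mul] at h2
    simpa using h2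
  · filter_upwards [avg_Lop ha F hη h] with z hz
    have h1 := (abs_le.1 hz).2
    have h2 := mul_le_mul_of_nonneg_left h1 (inv_pos.2 hη).le
    have e : η⁻¹ * (ε / r ^ 2 * η) = ε / r ^ 2 := by field_simp
    rw [e, mul_sub, Finset.mul_sum] at h2
    have e5 : ∑ i, ∑ j, a i j z.1 z.2 * ((-η⁻¹) • ∫ s in (z.1 - η)..z.1, F.D2 s z.2)
          (EuclideanSpace.single i 1) (EuclideanSpace.single j 1) =
        - ∑ i, η⁻¹ * ∑ j, a i j z.1 z.2 * (∫ s in (z.1 - η)..z.1, F.D2 s z.2)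
          (EuclideanSpace.single i 1) (EuclideanSpace.single j 1) := by
      rw [← Finset.sum_neg_distrib]
      refine Finset.sum_congr rfl fun i _ => ?_
      rw [Finset.mul_sum, ← Finset.sum_neg_distrib]
      refine Finset.sum_congr rfl fun j _ => ?_
      simp
      ring
    rw [e5]
    linarith

end Fn

/-! ### The two-point step -/

lemma pigeon_translates {d : ℕ} {m : ℕ} {c r t₀ : ℝ} {x₀ : EuclideanSpace ℝ (Fin d)}
    (hc : 0 < c) (hr : 0 < r) (hm : 2 ^ (d + 1) < (m + 1 : ℝ) * c)
    (S : Set (ℝ × EuclideanSpace ℝ (Fin d))) (hS : MeasurableSet S)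
    (hSQ : S ⊆ Icc (t₀ - r ^ 2) t₀ ×ˢ closedBall x₀ r)
    (hvol : ENNReal.ofReal (c * r ^ (d + 2)) *
        volume (ball (0 : EuclideanSpace ℝ (Fin d)) 1) ≤ volume S)
    (τ : Vec d) (h1 : m * (τ.1 : ℝ) ≤ r ^ 2) (h2 : m * ‖τ.2‖ ≤ r) :
    ∃ l : ℕ, 1 ≤ l ∧ l ≤ m ∧ ∃ z ∈ S, (z.1 - l * τ.1, z.2 + (l : ℝ) • τ.2) ∈ S := by
  set B : Set (ℝ × EuclideanSpace ℝ (Fin d)) :=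
    Icc (t₀ - 2 * r ^ 2) t₀ ×ˢ closedBall x₀ (2 * r) with hB
  set w : ℕ → ℝ × EuclideanSpace ℝ (Fin d) := fun l => (l * (τ.1 : ℝ), -((l : ℝ) • τ.2)) with hw
  set T : ℕ → Set (ℝ × EuclideanSpace ℝ (Fin d)) := fun l => (fun z => z + w l) ⁻¹' S with hT
  have hTm : ∀ l, MeasurableSet (T l) := fun l => measurable_add_const (w l) hS
  have hτ0 : (0:ℝ) ≤ τ.1 := τ.1.2
  have hTB : ∀ l ≤ m, T l ⊆ B := by
    intro l hl z hz
    have hl' : (l : ℝ) ≤ m := by exact_mod_cast hl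
    have := hSQ hz
    obtain ⟨⟨q1, q2⟩, q3⟩ := this
    simp only [hw, Prod.fst_add, Prod.snd_add] at q1 q2 q3
    have e1 : (l:ℝ) * τ.1 ≤ r ^ 2 := (mul_le_mul_of_nonneg_right hl' hτ0).trans h1
    have e2 : (l:ℝ) * ‖τ.2‖ ≤ r := (mul_le_mul_of_nonneg_right hl' (norm_nonneg _)).trans h2
    have e3 : (0:ℝ) ≤ l * τ.1 := by positivity
    refine ⟨⟨by linarith, by linarith⟩, ?_⟩
    rw [mem_closedBall, dist_eq_norm] at q3 ⊢
    have e4 : z.2 - x₀ = (z.2 + -((l:ℝ) • τ.2) - x₀) + (l:ℝ) • τ.2 := by abel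
    rw [e4]
    refine (norm_add_le _ _).trans ?_
    rw [norm_smul, Real.norm_natCast]
    linarith
  set ω := volume (ball (0 : EuclideanSpace ℝ (Fin d)) 1) with hω
  have hω0 : ω ≠ 0 := (measure_ball_pos _ _ one_pos).ne'
  have hωt : ω ≠ ⊤ := measure_ball_lt_top.ne
  have hvB : volume B = ENNReal.ofReal (2 ^ (d + 1) * r ^ (d + 2)) * ω := by
    rw [hB, Measure.volume_eq_prod, Measure.prod_prod, Real.volume_Icc,
      Measure.addHaar_closedBall _ _ (by positivity), ← mul_assoc, ← ENNReal.ofReal_mul (by nlinarith)]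
    congr 2
    simp only [finrank_euclideanSpace, Fintype.card_fin]
    ring
  have hmeas : (volume.restrict B) univ < ∑ l ∈ Finset.range (m + 1), (volume.restrict B) (T l) := by
    have e1 : ∀ l ∈ Finset.range (m + 1), volume S ≤ (volume.restrict B) (T l) := by
      intro l hl
      rw [Measure.restrict_apply (hTm l), inter_eq_left.2 (hTB l (by
        have := Finset.mem_range.1 hl; omega)), hT, measure_preimage_add_right]
    refine lt_of_lt_of_le ?_ (Finset.sum_le_sum e1)
    rw [Finset.sum_const, Finset.card_range, nsmul_eq_mul, Measure.restrict_apply_univ, hvB]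
    refine lt_of_lt_of_le ?_ (mul_le_mul_right hvol _)
    rw [← mul_assoc, ENNReal.mul_lt_mul_iff_left hω0 hωt]
    have e2 : ((m + 1 : ℕ) : ENNReal) = ENNReal.ofReal (m + 1 : ℝ) := by
      rw [← ENNReal.ofReal_natCast]; push_cast; rfl
    rw [e2, ← ENNReal.ofReal_mul (by positivity), ENNReal.ofReal_lt_ofReal_iff (by positivity),
      ← mul_assoc]
    exact mul_lt_mul_of_pos_right hm (by positivity)
  obtain ⟨i, hi, j, hj, hij, z, hzi, hzj⟩ := exists_nonempty_inter_of_measure_univ_lt_sum_measure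
    (volume.restrict B) (fun l _ => (hTm l).nullMeasurableSet) hmeas
  have key : ∀ i j : ℕ, i < j → j ≤ m → z ∈ T i → z ∈ T j →
      ∃ l : ℕ, 1 ≤ l ∧ l ≤ m ∧ ∃ z ∈ S, (z.1 - l * τ.1, z.2 + (l : ℝ) • τ.2) ∈ S := by
    intro i j hij hj hzi hzj
    refine ⟨j - i, by omega, by omega, z + w j, hzj, ?_⟩
    have : ((z + w j).1 - ((j - i : ℕ) : ℝ) * τ.1, (z + w j).2 + ((j - i : ℕ) : ℝ) • τ.2) =
        z + w i := by
      rw [Nat.cast_sub hij.le]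
      ext
      · simp [hw]; ring
      · simp [hw]; ring
    rw [this]
    exact hzi
  have hi' := Finset.mem_range.1 hi
  have hj' := Finset.mem_range.1 hj
  rcases lt_or_gt_of_ne hij with h | h
  · exact key i j h (by omega) hzi hzj
  · exact key j i h (by omega) hzj hzi

namespace Fn
variable {d : ℕ}

lemma shift_f (τ : Vec d) (F : Fn d) (t x) : (shift τ F).f t x = F.f (t - τ.1) (x + τ.2) := rfl

lemma shift_nsmul_f (l : ℕ) (τ : Vec d) (F : Fn d) (t x) :
    (shift (l • τ) F).f t x = F.f (t - l * τ.1) (x + (l:ℝ) • τ.2) := by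
  rw [shift_f]
  simp [Nat.cast_smul_eq_nsmul]

lemma pstep (d : ℕ) {ν : ℝ} (hν : 0 < ν) : ∃ m : ℕ, 1 ≤ m ∧
    ∀ (q : ℕ) (a : Fin d → Fin d → ℝ → EuclideanSpace ℝ (Fin d) → ℝ),
    UnifEllipticP d ν a → CInv d q a → ∀ (F : Fn d) (A t₀ r ε : ℝ) (x₀ : EuclideanSpace ℝ (Fin d)),
    t₀ < 0 → 0 < r → 0 < ε → (∀ t < (0:ℝ), ∀ x, F.f t x ≤ A) → A - ε < F.f t₀ x₀ →
    AEB a (ε / r ^ 2) F → ∀ τ : Vec d, m * (τ.1 : ℝ) ≤ r ^ 2 → m * ‖τ.2‖ ≤ r →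
    ∃ l : ℕ, 1 ≤ l ∧ l ≤ m ∧ ∃ t < (0:ℝ), ∃ x,
      A - 4 * ε ≤ (F.f t x + (shift (l • τ) F).f t x) / 2 := by
  have hC : 0 < abpC d ν := by unfold abpC; positivity
  set c : ℝ := ν ^ d / abpC d ν ^ (d + 1) with hc
  have hc0 : 0 < c := by positivity
  obtain ⟨m, hm⟩ := exists_nat_gt (2 ^ (d + 1) / c)
  have hm0 : (0:ℝ) < m := lt_trans (by positivity) hm
  refine ⟨m, by exact_mod_cast hm0, ?_⟩
  intro q a hell ha F A t₀ r ε x₀ ht₀ hr hε hA h0 hL τ h1 h2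
  rw [div_lt_iff₀ hc0] at hm
  -- choice of the averaging length
  obtain ⟨η, hη, hη2⟩ : ∃ η > 0, ∀ s ∈ Icc (t₀ - η) t₀, A - ε ≤ F.f s x₀ := by
    have hcont : ContinuousAt (fun s => F.f s x₀) t₀ :=
      (slice_cont F.cf x₀).continuousAt (Iio_mem_nhds ht₀)
    obtain ⟨η, hη, hh⟩ := Metric.eventually_nhds_iff_ball.1 (hcont.eventually (lt_mem_nhds h0))
    refine ⟨η / 2, by positivity, fun s hs => (hh s ?_).le⟩
    rw [mem_ball, Real.dist_eq, abs_lt]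
    constructor <;> linarith [hs.1, hs.2]
  have h0' : A - η⁻¹ * ∫ s in (t₀ - η)..t₀, F.f s x₀ ≤ ε := by
    have h3 : ∫ s in (t₀ - η)..t₀, (A - ε) ≤ ∫ s in (t₀ - η)..t₀, F.f s x₀ :=
      intervalIntegral.integral_mono_on (by linarith) intervalIntegrable_const
        (slice_int F.cf x₀ ht₀ hη.le) fun s hs => hη2 s hs
    rw [intervalIntegral.integral_const, sub_sub_cancel, smul_eq_mul] at h3
    have h4 := mul_le_mul_of_nonneg_left h3 (inv_pos.2 hη).le
    rw [← mul_assoc, inv_mul_cancel₀ hη.ne', one_mul] at h4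
    linarith
  have hvol := abp_avg hν hell ha F hη ht₀ hr hε hA h0' hL
  have hcl : IsClosed (Icc (t₀ - r ^ 2) t₀ ×ˢ closedBall x₀ r) :=
    isClosed_Icc.prod isClosed_closedBall
  have hsub : Icc (t₀ - r ^ 2) t₀ ×ˢ closedBall x₀ r ⊆ parNeg d := fun z hz =>
    ⟨lt_of_le_of_lt hz.1.2 ht₀, mem_univ _⟩
  have hvc : ContinuousOn (fun z : ℝ × EuclideanSpace ℝ (Fin d) =>
      A - η⁻¹ * ∫ s in (z.1 - η)..z.1, F.f s z.2) (Icc (t₀ - r ^ 2) t₀ ×ˢ closedBall x₀ r) :=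
    (continuousOn_const.sub (continuousOn_const.mul (avg_cont hη.le F.f F.cf))).mono hsub
  have hSm : MeasurableSet {z : ℝ × EuclideanSpace ℝ (Fin d) |
      z ∈ Icc (t₀ - r ^ 2) t₀ ×ˢ closedBall x₀ r ∧
        A - η⁻¹ * ∫ s in (z.1 - η)..z.1, F.f s z.2 ≤ 4 * ε} :=
    (hvc.preimage_isClosed_of_isClosed hcl (isClosed_Iic (a := 4 * ε))).measurableSet
  obtain ⟨l, hl1, hlm, z, hz, hz'⟩ := pigeon_translates hc0 hr
    (by linarith) _ hSm (fun z hz => hz.1) hvol τ h1 h2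
  refine ⟨l, hl1, hlm, ?_⟩
  have hz1 : z.1 < 0 := (hsub hz.1).1
  have hav1 := hz.2
  have hav2 := hz'.2
  simp only at hav2
  by_contra hcon
  push Not at hcon
  have hI1 := slice_int F.cf z.2 hz1 hη.le
  have hI2 := slice_int (shift (l • τ) F).cf z.2 hz1 hη.le
  have e1 : ∫ s in (z.1 - l * τ.1 - η)..(z.1 - l * τ.1), F.f s (z.2 + (l:ℝ) • τ.2) =
      ∫ s in (z.1 - η)..z.1, (shift (l • τ) F).f s z.2 := by
    simp_rw [shift_nsmul_f]
    rw [intervalIntegral.integral_comp_sub_right (fun s => F.f s (z.2 + (l:ℝ) • τ.2))]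
    congr 1; ring
  rw [e1] at hav2
  have hlt : ∫ s in (z.1 - η)..z.1, (F.f s z.2 + (shift (l • τ) F).f s z.2) / 2 <
      ∫ s in (z.1 - η)..z.1, (A - 4 * ε) := by
    have hs : Icc (z.1 - η) z.1 ⊆ Iio 0 := fun s hs => lt_of_le_of_lt hs.2 hz1
    refine intervalIntegral.integral_lt_integral_of_continuousOn_of_le_of_exists_lt (by linarith)
      ?_ continuousOn_const (fun s hs => (hcon s (lt_of_le_of_lt hs.2 hz1) z.2).le)
      ⟨z.1, ⟨by linarith, le_rfl⟩, hcon _ hz1 _⟩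
    exact (((slice_cont F.cf z.2).add (slice_cont (shift (l • τ) F).cf z.2)).div_const 2).mono hs
  rw [intervalIntegral.integral_div, intervalIntegral.integral_add hI1 hI2,
    intervalIntegral.integral_const, sub_sub_cancel, smul_eq_mul] at hlt
  have h5 := mul_lt_mul_of_pos_left hlt (inv_pos.2 hη)
  rw [← mul_assoc, inv_mul_cancel₀ hη.ne', one_mul] at h5
  have h6 : η⁻¹ * (((∫ s in (z.1 - η)..z.1, F.f s z.2) +
      ∫ s in (z.1 - η)..z.1, (shift (l • τ) F).f s z.2) / 2) =
      (η⁻¹ * (∫ s in (z.1 - η)..z.1, F.f s z.2) +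
      η⁻¹ * ∫ s in (z.1 - η)..z.1, (shift (l • τ) F).f s z.2) / 2 := by ring
  rw [h6] at h5
  linarith

end Fn

/-! ### Two-point lemma and the doubling inequality -/

namespace Fn
variable {d : ℕ}

/-- conclusion of `pstep` -/
def PStep (d : ℕ) (ν : ℝ) (m : ℕ) : Prop :=
    ∀ (q : ℕ) (a : Fin d → Fin d → ℝ → EuclideanSpace ℝ (Fin d) → ℝ),
    UnifEllipticP d ν a → CInv d q a → ∀ (F : Fn d) (A t₀ r ε : ℝ) (x₀ : EuclideanSpace ℝ (Fin d)),
    t₀ < 0 → 0 < r → 0 < ε → (∀ t < (0:ℝ), ∀ x, F.f t x ≤ A) → A - ε < F.f t₀ x₀ →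
    AEB a (ε / r ^ 2) F → ∀ τ : Vec d, m * (τ.1 : ℝ) ≤ r ^ 2 → m * ‖τ.2‖ ≤ r →
    ∃ l : ℕ, 1 ≤ l ∧ l ≤ m ∧ ∃ t < (0:ℝ), ∃ x,
      A - 4 * ε ≤ (F.f t x + (shift (l • τ) F).f t x) / 2

lemma progress {ν : ℝ} {m : ℕ} (hm : PStep d ν m) {q : ℕ} {a} (hell : UnifEllipticP d ν a)
    (ha : CInv d q a) (τ : Vec d) (hτ : Xp q τ.2) {r : ℝ} (hr : 0 < r)
    (h1 : m * (τ.1 : ℝ) ≤ r ^ 2) (h2 : m * ‖τ.2‖ ≤ r) (A : ℝ) (n : ℕ) :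
    ∀ (F : Fn d) (t₀ ε : ℝ) (x₀ : EuclideanSpace ℝ (Fin d)),
    t₀ < 0 → 0 < ε → (∀ t < (0:ℝ), ∀ x, F.f t x ≤ A) → A - ε < F.f t₀ x₀ →
    AEB a (ε / r ^ 2) F →
    ∃ ls : List ℕ, ls.length = n ∧ (∀ l ∈ ls, 1 ≤ l ∧ l ≤ m) ∧ ∃ t < (0:ℝ), ∃ x,
      ∀ S : List ℕ, S.Sublist ls → A - 10 ^ n * ε ≤ F.f (t - S.sum * τ.1) (x + (S.sum : ℝ) • τ.2) := by
  induction n with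
  | zero =>
    intro F t₀ ε x₀ ht₀ hε hA h0 hL
    refine ⟨[], rfl, by simp, t₀, ht₀, x₀, ?_⟩
    intro S hS
    rw [List.sublist_nil] at hS
    subst hS
    simp
    linarith
  | succ n ih =>
    intro F t₀ ε x₀ ht₀ hε hA h0 hL
    obtain ⟨l, hl1, hlm, t, ht, x, hx⟩ := hm q a hell ha F A t₀ r ε x₀ ht₀ hr hε hA h0 hL τ h1 h2
    have hτl : Xp q (l • τ).2 := fun k hk => by simp [hτ k hk]
    have hF1 : AEB a (5 * ε / r ^ 2) (lin (1/2) (1/2) F (shift (l • τ) F)) := by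
      refine (hL.lin (hL.shift ha (l • τ) hτl) (1/2) (1/2)).mono ?_
      rw [abs_of_pos (by norm_num)]
      have : 0 < ε / r ^ 2 := by positivity
      have e : 5 * ε / r ^ 2 = 5 * (ε / r ^ 2) := by ring
      rw [e]; linarith
    have hA1 : ∀ t < (0:ℝ), ∀ x, (lin (1/2) (1/2) F (shift (l • τ) F)).f t x ≤ A := by
      intro t ht x
      have e1 := hA t ht x
      have e2 := hA _ (shift_lt ht (l • τ).1) (x + (l • τ).2)
      simp only [lin, shift]
      linarith
    obtain ⟨ls, hlen, hls, t', ht', x', hS⟩ := ih (lin (1/2) (1/2) F (shift (l • τ) F)) t (5 * ε) x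
      ht (by positivity) hA1 (by simp only [lin]; linarith) hF1
    have hp : (0:ℝ) ≤ 10 ^ n * ε := by positivity
    have hboth : ∀ S : List ℕ, S.Sublist ls →
        A - 10 ^ (n + 1) * ε ≤ F.f (t' - S.sum * τ.1) (x' + (S.sum : ℝ) • τ.2) ∧
        A - 10 ^ (n + 1) * ε ≤
          F.f (t' - S.sum * τ.1 - l * τ.1) (x' + (S.sum : ℝ) • τ.2 + (l : ℝ) • τ.2) := by
      intro S hs
      have e := hS S hs
      have ht2 : t' - S.sum * τ.1 < 0 := by
        have : (0:ℝ) ≤ S.sum * τ.1 := by positivity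
        linarith
      have e1 := hA _ ht2 (x' + (S.sum : ℝ) • τ.2)
      have e2 := hA _ (shift_lt ht2 (l • τ).1) (x' + (S.sum : ℝ) • τ.2 + (l • τ).2)
      rw [← shift_f, shift_nsmul_f] at e2
      have e3 : (lin (1/2) (1/2) F (shift (l • τ) F)).f (t' - S.sum * τ.1) (x' + (S.sum : ℝ) • τ.2) =
        1/2 * F.f (t' - S.sum * τ.1) (x' + (S.sum : ℝ) • τ.2) + 1/2 *
          F.f (t' - S.sum * τ.1 - l * τ.1) (x' + (S.sum : ℝ) • τ.2 + (l : ℝ) • τ.2) := by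
        rw [← shift_nsmul_f l τ F (t' - S.sum * τ.1)]; rfl
      rw [e3] at e
      rw [pow_succ]
      constructor <;> nlinarith
    refine ⟨l :: ls, by simp [hlen], ?_, t', ht', x', ?_⟩
    · intro k hk
      rcases List.mem_cons.1 hk with rfl | hk
      · exact ⟨hl1, hlm⟩
      · exact hls k hk
    · intro S hs
      rcases List.sublist_cons_iff.1 hs with hs | ⟨S', rfl, hs'⟩
      · exact (hboth S hs).1
      · have := (hboth S' hs').2
        have e1 : t' - ((l :: S').sum : ℕ) * (τ.1 : ℝ) = t' - S'.sum * τ.1 - l * τ.1 := by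
          simp; ring
        have e2 : x' + (((l :: S').sum : ℕ) : ℝ) • τ.2 = x' + (S'.sum : ℝ) • τ.2 + (l : ℝ) • τ.2 := by
          simp [add_smul]; abel
        rw [e1, e2]
        exact this

lemma two_point (d : ℕ) {ν : ℝ} (hν : 0 < ν) : ∃ C : ℝ, 0 < C ∧
    ∀ (q : ℕ) (a : Fin d → Fin d → ℝ → EuclideanSpace ℝ (Fin d) → ℝ),
    UnifEllipticP d ν a → CInv d q a → ∀ (F : Fn d) (A t₀ r ε : ℝ) (x₀ : EuclideanSpace ℝ (Fin d)),
    t₀ < 0 → 0 < r → 0 < ε → (∀ t < (0:ℝ), ∀ x, F.f t x ≤ A) → A - ε < F.f t₀ x₀ →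
    AEB a (ε / r ^ 2) F → ∀ τ : Vec d, Xp q τ.2 → (τ.1 : ℝ) ≤ r ^ 2 → ‖τ.2‖ ≤ r →
    ∃ t < (0:ℝ), ∃ x, A - C * ε ≤ F.f t x ∧ A - C * ε ≤ F.f (t - τ.1) (x + τ.2) := by
  obtain ⟨m, hm1, hm⟩ := pstep d hν
  set L := m.factorial with hL
  refine ⟨10 ^ (m * L), by positivity, ?_⟩
  intro q a hell ha F A t₀ r ε x₀ ht₀ hr hε hA h0 hLop τ hτ h1 h2
  have hL0 : 0 < L := Nat.factorial_pos m
  have hmL : (m : ℝ) ≤ L := by exact_mod_cast Nat.self_le_factorial m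
  have hL0' : (0:ℝ) < L := by exact_mod_cast hL0
  set τ₀ : Vec d := (τ.1 / L, (L : ℝ)⁻¹ • τ.2) with hτ₀
  have e1 : (L : ℝ) * (τ₀.1 : ℝ) = τ.1 := by
    simp only [hτ₀, NNReal.coe_div, NNReal.coe_natCast]
    field_simp
  have e2 : (L : ℝ) • τ₀.2 = τ.2 := by
    simp only [hτ₀, smul_smul]
    rw [mul_inv_cancel₀ hL0'.ne', one_smul]
  have e3 : (L:ℝ) * ‖τ₀.2‖ = ‖τ.2‖ := by
    have := congrArg norm e2
    rwa [norm_smul (L:ℝ) τ₀.2, Real.norm_natCast] at this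
  have hτ₀' : Xp q τ₀.2 := fun k hk => by simp [hτ₀, hτ k hk]
  obtain ⟨ls, hlen, hls, t, ht, x, hS⟩ := progress hm hell ha τ₀ hτ₀' hr
    (le_trans (mul_le_mul_of_nonneg_right hmL τ₀.1.2) (by linarith))
    (le_trans (mul_le_mul_of_nonneg_right hmL (norm_nonneg _)) (by linarith)) A (m * L) F t₀ ε x₀
    ht₀ hε hA h0 hLop
  refine ⟨t, ht, x, by simpa using hS [] (List.nil_sublist _), ?_⟩
  have hcount : ∑ l ∈ Finset.Icc 1 m, ls.count l = m * L := by
    have := Multiset.sum_count_eq_card (s := Finset.Icc 1 m) (m := (ls : Multiset ℕ)) (by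
      intro l hl
      exact Finset.mem_Icc.2 (hls l (by simpa using hl)))
    simpa [hlen] using this
  obtain ⟨l, hl, hlL⟩ := Finset.exists_le_of_sum_le (s := Finset.Icc 1 m) (f := fun _ => L)
    (g := fun l => ls.count l) ⟨1, Finset.mem_Icc.2 ⟨le_rfl, hm1⟩⟩ (by
      rw [hcount]; simp)
  obtain ⟨hl1, hlm⟩ := Finset.mem_Icc.1 hl
  have hdvd : l ∣ L := Nat.dvd_factorial (by omega) hlm
  have hsub : (List.replicate (L / l) l).Sublist ls :=
    List.replicate_sublist_iff.2 ((Nat.div_le_self _ _).trans hlL)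
  have := hS _ hsub
  rw [List.sum_replicate, smul_eq_mul, Nat.div_mul_cancel hdvd, e1, e2] at this
  exact this

lemma dbl (d : ℕ) {ν : ℝ} (hν : 0 < ν) : ∃ C : ℝ, 0 < C ∧
    ∀ (q : ℕ) (a : Fin d → Fin d → ℝ → EuclideanSpace ℝ (Fin d) → ℝ),
    UnifEllipticP d ν a → CInv d q a → ∀ (ψ : Fn d) (r κ : ℝ), 0 < r → 0 ≤ κ →
    ∀ τ : Vec d, Xp q τ.2 → (τ.1 : ℝ) ≤ r ^ 2 → ‖τ.2‖ ≤ r → AEB a κ (dl τ ψ) →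
    (dl τ ψ).nrm ≤ (dl (2 • τ) ψ).nrm / 2 + C * κ * r ^ 2 := by
  obtain ⟨C, hC, h⟩ := two_point d hν
  refine ⟨C, hC, ?_⟩
  intro q a hell ha ψ r κ hr hκ τ hτ h1 h2 hL
  have key : ∀ ε, κ * r ^ 2 ≤ ε → 0 < ε → (dl τ ψ).nrm ≤ (dl (2 • τ) ψ).nrm / 2 + C * ε := by
    intro ε hε hε0
    obtain ⟨y, ⟨t₀, ht₀, x₀, rfl⟩, hy⟩ := exists_lt_of_lt_csSup (s := {y | ∃ t < (0:ℝ), ∃ x,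
      y = |(dl τ ψ).f t x|}) (b := (dl τ ψ).nrm - ε) ⟨_, -1, by norm_num, 0, rfl⟩ (by
        change _ < (dl τ ψ).nrm; linarith)
    have hκ' : κ ≤ ε / r ^ 2 := by rwa [le_div_iff₀ (by positivity)]
    have main : ∀ σ : ℝ, |σ| = 1 → (dl τ ψ).nrm - ε < σ * (dl τ ψ).f t₀ x₀ →
        (dl τ ψ).nrm ≤ (dl (2 • τ) ψ).nrm / 2 + C * ε := by
      intro σ hσ hy
      have hF : AEB a (ε / r ^ 2) (lin σ 0 (dl τ ψ) (dl τ ψ)) := by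
        refine (hL.lin hL σ 0).mono ?_
        rw [hσ]; simpa using hκ'
      have hf : ∀ t x, (lin σ 0 (dl τ ψ) (dl τ ψ)).f t x = σ * (dl τ ψ).f t x := fun t x => by
        simp [lin]
      obtain ⟨t, ht, x, g1, g2⟩ := h q a hell ha (lin σ 0 (dl τ ψ) (dl τ ψ)) (dl τ ψ).nrm t₀ r ε x₀
        ht₀ hr hε0 (fun t ht x => by
          rw [hf]
          refine (le_abs_self _).trans ?_
          rw [abs_mul, hσ, one_mul]
          exact le_nrm _ ht x) (by rw [hf]; exact hy) hF τ hτ h1 h2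
      rw [hf] at g1 g2
      have g3 := (le_abs_self _).trans_eq (abs_mul σ ((dl (2 • τ) ψ).f t x))
      rw [hσ, one_mul] at g3
      have g4 := g3.trans (le_nrm (dl (2 • τ) ψ) ht x)
      have g5 : (dl (2 • τ) ψ).f t x = (dl τ ψ).f t x + (dl τ ψ).f (t - τ.1) (x + τ.2) := by
        rw [dl_f, dl_f, dl_f]
        have q1 : t - ((2 • τ).1 : ℝ) = t - τ.1 - τ.1 := by simp; ring
        have q2 : x + (2 • τ).2 = x + τ.2 + τ.2 := by simp [two_smul]; abel
        rw [q1, q2]; ring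
      rw [g5, mul_add] at g4
      linarith
    rcases abs_cases ((dl τ ψ).f t₀ x₀) with ⟨e, _⟩ | ⟨e, _⟩
    · exact main 1 (by simp) (by rw [one_mul, ← e]; exact hy)
    · exact main (-1) (by simp) (by rw [neg_one_mul, ← e]; exact hy)
  refine le_of_forall_pos_le_add fun η hη => ?_
  have := key (κ * r ^ 2 + η / C) (by have : 0 < η / C := by positivity
                                      linarith) (by positivity)
  rw [mul_add, mul_div_cancel₀ _ hC.ne'] at this
  linarith

end Fn

/-! ### Iteration lemmas -/

lemma up_iter {D : ℕ → ℝ} {θ c G M : ℝ} (hθ : 0 ≤ θ) (hθ1 : θ < 1) (hc : 0 ≤ c) (hθc : θ * c < 1)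
    (hG : 0 ≤ G) (hM : ∀ j, D j ≤ M) (h : ∀ j, D j ≤ θ * D (j + 1) + G * c ^ j) :
    D 0 ≤ G / (1 - θ * c) := by
  have hp : 0 < 1 - θ * c := by linarith
  have h1 : ∀ n, D 0 ≤ θ ^ n * D n + G * (1 - (θ * c) ^ n) / (1 - θ * c) := by
    intro n
    induction n with
    | zero => simp
    | succ n ih =>
      have h2 := mul_le_mul_of_nonneg_left (h n) (pow_nonneg hθ n)
      have e : θ ^ (n + 1) * D (n + 1) + G * (1 - (θ * c) ^ (n + 1)) / (1 - θ * c) =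
          θ ^ n * (θ * D (n + 1) + G * c ^ n) + G * (1 - (θ * c) ^ n) / (1 - θ * c) := by
        field_simp
        rw [mul_pow, mul_pow]
        ring
      rw [e]; linarith
  have h2 : ∀ n, D 0 ≤ θ ^ n * M + G / (1 - θ * c) := by
    intro n
    refine (h1 n).trans (add_le_add (mul_le_mul_of_nonneg_left (hM n) (pow_nonneg hθ n)) ?_)
    refine div_le_div_of_nonneg_right ?_ hp.le
    have : 0 ≤ (θ * c) ^ n := by positivity
    nlinarith
  have h3 : Tendsto (fun n : ℕ => θ ^ n * M + G / (1 - θ * c)) atTop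
      (nhds (0 * M + G / (1 - θ * c))) :=
    ((tendsto_pow_atTop_nhds_zero_of_lt_one hθ hθ1).mul_const M).add_const _
  rw [zero_mul, zero_add] at h3
  exact ge_of_tendsto' h3 h2

lemma down_iter {D : ℕ → ℝ} {θ b G : ℝ} (hb : 0 ≤ b) (hbθ : b < θ) (hG : 0 ≤ G)
    (h : ∀ j, D (j + 1) ≤ θ * D j + G * b ^ j) (j : ℕ) :
    D j ≤ θ ^ j * (D 0 + G / (θ - b)) := by
  have hp : 0 < θ - b := by linarith
  have hθ : 0 ≤ θ := by linarith
  have h1 : D j ≤ θ ^ j * D 0 + G * (θ ^ j - b ^ j) / (θ - b) := by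
    induction j with
    | zero => simp
    | succ n ih =>
      have h2 := mul_le_mul_of_nonneg_left ih hθ
      have e : θ ^ (n + 1) * D 0 + G * (θ ^ (n + 1) - b ^ (n + 1)) / (θ - b) =
          θ * (θ ^ n * D 0 + G * (θ ^ n - b ^ n) / (θ - b)) + G * b ^ n := by
        field_simp
        ring
      rw [e]
      linarith [h n]
  refine h1.trans ?_
  have h4 : G * (θ ^ j - b ^ j) / (θ - b) ≤ θ ^ j * (G / (θ - b)) := by
    rw [← mul_div_assoc]
    refine div_le_div_of_nonneg_right ?_ hp.le
    have : 0 ≤ G * b ^ j := by positivity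
    nlinarith
  rw [mul_add]; linarith

lemma deriv_bound {g : ℝ → ℝ} {g' B ρ : ℝ} {e : ℕ → ℝ} (hg : HasDerivAt g g' 0) (hρ : 0 < ρ)
    (he : Tendsto e atTop (nhds 0))
    (h : ∀ k : ℕ, |g ((1/2) ^ k * ρ) - g 0| ≤ (1/2) ^ k * ρ * (B + e k)) : |g'| ≤ B := by
  have h1 : Tendsto (fun k : ℕ => (1/2 : ℝ) ^ k * ρ) atTop (nhdsWithin 0 (Ioi 0)) := by
    rw [tendsto_nhdsWithin_iff]
    constructor
    · have := (tendsto_pow_atTop_nhds_zero_of_lt_one (r := (1/2:ℝ)) (by norm_num)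
        (by norm_num)).mul_const ρ
      rwa [zero_mul] at this
    · exact Eventually.of_forall fun k => mem_Ioi.2 (by positivity)
  have h2 := (hg.tendsto_slope_zero_right.comp h1).abs
  have h3 : Tendsto (fun k => B + e k) atTop (nhds (B + 0)) := he.const_add B
  rw [add_zero] at h3
  refine le_of_tendsto_of_tendsto' h2 h3 fun k => ?_
  have hk : 0 < (1/2 : ℝ) ^ k * ρ := by positivity
  simp only [Function.comp, zero_add, smul_eq_mul]
  rw [abs_mul, abs_of_pos (inv_pos.2 hk), inv_mul_le_iff₀ hk]
  exact h k

/-- time translation -/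
def tv {d : ℕ} (s : NNReal) : Vec d := (s, 0)
/-- space translation -/
def xv {d : ℕ} (h : EuclideanSpace ℝ (Fin d)) : Vec d := (0, h)

lemma two_tv {d : ℕ} (s : NNReal) : (2 • tv s : Vec d) = tv (2 * s) := by
  ext <;> simp [tv]
lemma two_xv {d : ℕ} (h : EuclideanSpace ℝ (Fin d)) : (2 • xv h : Vec d) = xv ((2:ℝ) • h) := by
  ext <;> simp [xv]

namespace Fn
variable {d : ℕ}

/-- conclusion of `dbl` for a fixed operator -/
def DB (q : ℕ) (a : Fin d → Fin d → ℝ → EuclideanSpace ℝ (Fin d) → ℝ) (C : ℝ) : Prop :=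
  ∀ (ψ : Fn d) (r κ : ℝ), 0 < r → 0 ≤ κ →
    ∀ τ : Vec d, Xp q τ.2 → (τ.1 : ℝ) ≤ r ^ 2 → ‖τ.2‖ ≤ r → AEB a κ (dl τ ψ) →
    (dl τ ψ).nrm ≤ (dl (2 • τ) ψ).nrm / 2 + C * κ * r ^ 2

lemma DB2 {q : ℕ} {a} {C : ℝ} (H : DB q a C) (ψ : Fn d) {r κ : ℝ} (hr : 0 < r) (hκ : 0 ≤ κ)
    (τ σ : Vec d) (hτ : Xp q τ.2) (hσ : Xp q σ.2) (hτ1 : (τ.1 : ℝ) ≤ r ^ 2) (hτ2 : ‖τ.2‖ ≤ r)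
    (hσ1 : (σ.1 : ℝ) ≤ r ^ 2) (hσ2 : ‖σ.2‖ ≤ r)
    (h1 : AEB a κ (dl τ (dl σ ψ))) (h2 : AEB a κ (dl (2 • τ) (dl σ ψ))) :
    (dl τ (dl σ ψ)).nrm ≤ 1 / 4 * (dl (2 • τ) (dl (2 • σ) ψ)).nrm + 3 / 2 * (C * κ * r ^ 2) := by
  have e1 := H (dl σ ψ) r κ hr hκ τ hτ hτ1 hτ2 h1
  rw [dl_comm (2 • τ) σ] at h2
  have e2 := H (dl (2 • τ) ψ) r κ hr hκ σ hσ hσ1 hσ2 h2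
  rw [dl_comm σ, dl_comm (2 • σ)] at e2
  linarith

lemma nrm_dl2_le (τ σ : Vec d) (F : Fn d) : (dl τ (dl σ F)).nrm ≤ 4 * F.nrm := by
  have := nrm_dl_le τ (dl σ F)
  have := nrm_dl_le σ F
  linarith

lemma nrm_dl3_le (τ σ ρ : Vec d) (F : Fn d) : (dl τ (dl σ (dl ρ F))).nrm ≤ 8 * F.nrm := by
  have := nrm_dl2_le τ σ (dl ρ F)
  have := nrm_dl_le ρ F
  linarith

lemma Xp_zero {q : ℕ} : Xp q (0 : EuclideanSpace ℝ (Fin d)) := fun _ _ => rfl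
lemma _root_.Xp.smul {q : ℕ} {h : EuclideanSpace ℝ (Fin d)} (hh : Xp q h) (c : ℝ) : Xp q (c • h) :=
  fun k hk => by simp [hh k hk]

lemma rpow_pow_mul (β : ℝ) (c : ℝ) (hc : 0 ≤ c) (j : ℕ) {s : ℝ} (hs : 0 ≤ s) :
    (c ^ j * s) ^ β = (c ^ β) ^ j * s ^ β := by
  rw [Real.mul_rpow (by positivity) hs]
  congr 1
  rw [← Real.rpow_natCast, ← Real.rpow_natCast, ← Real.rpow_mul hc, ← Real.rpow_mul hc, mul_comm]

/-- second time differences -/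
lemma tt_est {q : ℕ} {a} (ha : CInv d q a) {C : ℝ} (hC : 0 ≤ C) (H : DB q a C) {δ : ℝ} (hδ0 : 0 < δ)
    (hδ1 : δ < 1) {K : ℝ} (hK : 0 ≤ K) (u : Fn d)
    (h1 : ∀ s : NNReal, AEB a (K * (s:ℝ) ^ (δ / 2)) (dl (tv s) u)) (s : NNReal) (hs : 0 < s) :
    (dl (tv s) (dl (tv s) u)).nrm ≤ 3 * C / (1 - 1 / 4 * 2 ^ (1 + δ / 2)) * K * s ^ (1 + δ / 2) := by
  have hs' : (0:ℝ) < s := hs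
  have hstep : ∀ σ : NNReal, 0 < σ → (dl (tv σ) (dl (tv σ) u)).nrm ≤
      1 / 4 * (dl (tv (2 * σ)) (dl (tv (2 * σ)) u)).nrm + 3 * C * K * σ ^ (1 + δ / 2) := by
    intro σ hσ
    have hσ' : (0:ℝ) < σ := hσ
    have hsq : Real.sqrt σ ^ 2 = σ := Real.sq_sqrt hσ'.le
    have := DB2 H u (r := Real.sqrt σ) (κ := 2 * (K * (σ:ℝ) ^ (δ / 2))) (Real.sqrt_pos.2 hσ')
      (by positivity) (tv σ) (tv σ) Xp_zero Xp_zero (by rw [hsq]; rfl) (by simp [tv])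
      (by rw [hsq]; rfl) (by simp [tv]) ((h1 σ).dl ha _ Xp_zero)
      ((h1 σ).dl ha _ (by rw [two_tv]; exact Xp_zero))
    rw [two_tv, hsq] at this
    refine this.trans_eq ?_
    rw [Real.rpow_add hσ', Real.rpow_one]
    ring
  have h2 : (2:ℝ) ^ (1 + δ / 2) < 4 := by
    calc (2:ℝ) ^ (1 + δ / 2) < 2 ^ (2:ℝ) := Real.rpow_lt_rpow_of_exponent_lt (by norm_num) (by linarith)
      _ = 4 := by norm_num
  have := up_iter (D := fun j => (dl (tv (2 ^ j * s)) (dl (tv (2 ^ j * s)) u)).nrm) (θ := 1 / 4)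
    (c := 2 ^ (1 + δ / 2)) (G := 3 * C * K * s ^ (1 + δ / 2)) (M := 4 * u.nrm) (by norm_num)
    (by norm_num) (by positivity) (by linarith) (by positivity) (fun j => nrm_dl2_le _ _ _) (by
      intro j
      have := hstep (2 ^ j * s) (by positivity)
      rw [← mul_assoc, ← pow_succ'] at this
      push_cast at this
      rw [rpow_pow_mul _ _ (by norm_num) j hs'.le] at this
      refine this.trans_eq ?_
      ring)
  simp only [pow_zero, one_mul] at this
  refine this.trans_eq ?_
  ring

lemma pow_two_add_lt {δ : ℝ} (hδ1 : δ < 1) : (2:ℝ) ^ (2 + δ) < 8 := by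
  calc (2:ℝ) ^ (2 + δ) < 2 ^ (3:ℝ) := Real.rpow_lt_rpow_of_exponent_lt (by norm_num) (by linarith)
      _ = 8 := by norm_num

/-- mixed time-space differences -/
lemma tx_est {q : ℕ} {a} (ha : CInv d q a) {C : ℝ} (hC : 0 ≤ C) (H : DB q a C) {δ : ℝ} (hδ0 : 0 < δ)
    (hδ1 : δ < 1) {K : ℝ} (hK : 0 ≤ K) (u : Fn d)
    (h2 : ∀ h, Xp q h → AEB a (K * ‖h‖ ^ δ) (dl (xv h) u)) (s : NNReal)
    (h : EuclideanSpace ℝ (Fin d)) (hh : Xp q h) {ρ : ℝ} (hρ : 0 < ρ) (hsρ : (s:ℝ) ≤ ρ ^ 2)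
    (hhρ : ‖h‖ ≤ ρ) :
    (dl (tv s) (dl (xv h) u)).nrm ≤ 14 * C / (1 - 1 / 8 * 2 ^ (2 + δ)) * K * ρ ^ (2 + δ) := by
  have hstep : ∀ (s : NNReal) (h : EuclideanSpace ℝ (Fin d)) (ρ : ℝ), Xp q h → 0 < ρ →
      (s:ℝ) ≤ ρ ^ 2 → ‖h‖ ≤ ρ → (dl (tv s) (dl (xv h) u)).nrm ≤
      1 / 8 * (dl (tv (4 * s)) (dl (xv ((2:ℝ) • h)) u)).nrm + 14 * C * K * ρ ^ (2 + δ) := by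
    intro s h ρ hh hρ hsρ hhρ
    have hb : ∀ σ : NNReal, AEB a (2 * (K * ρ ^ δ)) (dl (tv σ) (dl (xv h) u)) := fun σ =>
      ((h2 h hh).dl ha (tv σ) Xp_zero).mono (by gcongr)
    have hκ : 0 ≤ 2 * (K * ρ ^ δ) := by positivity
    have e1 := H (dl (xv h) u) (2 * ρ) _ (by positivity) hκ (tv s) Xp_zero
      (by change (s:ℝ) ≤ _; nlinarith) (by simp [tv]; positivity) (hb s)
    have e2 := H (dl (xv h) u) (2 * ρ) _ (by positivity) hκ (tv (2 * s)) Xp_zero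
      (by change ((2 * s : NNReal):ℝ) ≤ _; push_cast; nlinarith) (by simp [tv]; positivity) (hb _)
    have e3' := hb (4 * s)
    rw [dl_comm] at e3'
    have e3 := H (dl (tv (4 * s)) u) (2 * ρ) _ (by positivity) hκ (xv h) hh
      (by change ((0:NNReal):ℝ) ≤ _; simp; positivity) (by change ‖h‖ ≤ _; linarith) e3'
    rw [two_tv] at e1 e2
    rw [← mul_assoc, show (2 * 2 : NNReal) = 4 by norm_num] at e2
    rw [two_xv, dl_comm (xv h), dl_comm (xv ((2:ℝ) • h))] at e3
    have e4 : C * (2 * (K * ρ ^ δ)) * (2 * ρ) ^ 2 = 8 * C * K * ρ ^ (2 + δ) := by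
      rw [Real.rpow_add hρ]; norm_cast; ring
    rw [e4] at e1 e2 e3
    linarith
  have h8 := pow_two_add_lt hδ1
  have := up_iter (D := fun j => (dl (tv (4 ^ j * s)) (dl (xv ((2:ℝ) ^ j • h)) u)).nrm) (θ := 1 / 8)
    (c := 2 ^ (2 + δ)) (G := 14 * C * K * ρ ^ (2 + δ)) (M := 4 * u.nrm) (by norm_num)
    (by norm_num) (by positivity) (by linarith) (by positivity) (fun j => nrm_dl2_le _ _ _) (by
      intro j
      have := hstep (4 ^ j * s) ((2:ℝ) ^ j • h) (2 ^ j * ρ) (hh.smul _) (by positivity) (by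
        push_cast
        rw [mul_pow, ← pow_mul, mul_comm j 2, pow_mul]
        norm_num
        exact hsρ) (by
        rw [norm_smul, norm_pow, Real.norm_ofNat]
        gcongr)
      rw [← mul_assoc, ← pow_succ', smul_smul, ← pow_succ',
        rpow_pow_mul _ _ (by norm_num) j hρ.le] at this
      refine this.trans_eq ?_
      ring)
  simp only [pow_zero, one_mul, one_smul] at this
  refine this.trans_eq ?_
  ring

/-- third space differences -/
lemma xxx_est {q : ℕ} {a} (ha : CInv d q a) {C : ℝ} (hC : 0 ≤ C) (H : DB q a C) {δ : ℝ}
    (hδ0 : 0 < δ) (hδ1 : δ < 1) {K : ℝ} (hK : 0 ≤ K) (u : Fn d)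
    (h2 : ∀ h, Xp q h → AEB a (K * ‖h‖ ^ δ) (dl (xv h) u))
    (h k l : EuclideanSpace ℝ (Fin d)) (hh : Xp q h) (hk : Xp q k) (hl : Xp q l) {ρ : ℝ}
    (hρ : 0 < ρ) (hhρ : ‖h‖ ≤ ρ) (hkρ : ‖k‖ ≤ ρ) (hlρ : ‖l‖ ≤ ρ) :
    (dl (xv h) (dl (xv k) (dl (xv l) u))).nrm ≤
      7 * C / (1 - 1 / 8 * 2 ^ (2 + δ)) * K * ρ ^ (2 + δ) := by
  have hstep : ∀ (h k l : EuclideanSpace ℝ (Fin d)) (ρ : ℝ), Xp q h → Xp q k → Xp q l → 0 < ρ →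
      ‖h‖ ≤ ρ → ‖k‖ ≤ ρ → ‖l‖ ≤ ρ → (dl (xv h) (dl (xv k) (dl (xv l) u))).nrm ≤
      1 / 8 * (dl (xv ((2:ℝ) • h)) (dl (xv ((2:ℝ) • k)) (dl (xv ((2:ℝ) • l)) u))).nrm +
        7 * C * K * ρ ^ (2 + δ) := by
    intro h k l ρ hh hk hl hρ hhρ hkρ hlρ
    have hb : ∀ v w : EuclideanSpace ℝ (Fin d), Xp q v → Xp q w →
        AEB a (2 * (2 * (K * ρ ^ δ))) (dl (xv v) (dl (xv w) (dl (xv l) u))) := fun v w hv hw =>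
      (((h2 l hl).dl ha (xv w) hw).dl ha (xv v) hv).mono (by gcongr)
    have hκ : 0 ≤ 2 * (2 * (K * ρ ^ δ)) := by positivity
    have e1 := DB2 H (dl (xv l) u) hρ hκ (xv h) (xv k) hh hk
      (by change ((0:NNReal):ℝ) ≤ _; simp; positivity) hhρ
      (by change ((0:NNReal):ℝ) ≤ _; simp; positivity) hkρ (hb _ _ hh hk)
      (by rw [two_xv]; exact hb _ _ (hh.smul 2) hk)
    have e3' := hb _ _ (hh.smul 2) (hk.smul 2)
    rw [dl_comm (xv ((2:ℝ) • k)), dl_comm (xv ((2:ℝ) • h)) (xv l)] at e3'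
    have e3 := H (dl (xv ((2:ℝ) • h)) (dl (xv ((2:ℝ) • k)) u)) ρ _ hρ hκ (xv l) hl
      (by change ((0:NNReal):ℝ) ≤ _; simp; positivity) hlρ e3'
    rw [two_xv, two_xv] at e1
    rw [two_xv, dl_comm (xv l), dl_comm (xv l), dl_comm (xv ((2:ℝ) • l)),
      dl_comm (xv ((2:ℝ) • l))] at e3
    have e4 : C * (2 * (2 * (K * ρ ^ δ))) * ρ ^ 2 = 4 * C * K * ρ ^ (2 + δ) := by
      rw [Real.rpow_add hρ]; norm_cast; ring
    rw [e4] at e1 e3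
    linarith
  have h8 := pow_two_add_lt hδ1
  have := up_iter (D := fun j => (dl (xv ((2:ℝ) ^ j • h)) (dl (xv ((2:ℝ) ^ j • k))
    (dl (xv ((2:ℝ) ^ j • l)) u))).nrm) (θ := 1 / 8)
    (c := 2 ^ (2 + δ)) (G := 7 * C * K * ρ ^ (2 + δ)) (M := 8 * u.nrm) (by norm_num)
    (by norm_num) (by positivity) (by linarith) (by positivity) (fun j => nrm_dl3_le _ _ _ _) (by
      intro j
      have hn : ∀ v : EuclideanSpace ℝ (Fin d), ‖v‖ ≤ ρ → ‖(2:ℝ) ^ j • v‖ ≤ 2 ^ j * ρ := by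
        intro v hv
        rw [norm_smul, norm_pow, Real.norm_ofNat]
        gcongr
      have := hstep ((2:ℝ) ^ j • h) ((2:ℝ) ^ j • k) ((2:ℝ) ^ j • l) (2 ^ j * ρ) (hh.smul _)
        (hk.smul _) (hl.smul _) (by positivity) (hn h hhρ) (hn k hkρ) (hn l hlρ)
      simp only [smul_smul, ← pow_succ'] at this
      rw [rpow_pow_mul _ _ (by norm_num) j hρ.le] at this
      refine this.trans_eq ?_
      ring)
  simp only [pow_zero, one_smul] at this
  refine this.trans_eq ?_
  ring

end Fn

/-! ### Bounds for derivatives -/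

namespace Fn
variable {d : ℕ}

lemma half_rpow_lt {β γ : ℝ} (h : γ < β) : (1/2 : ℝ) ^ β < (1/2) ^ γ :=
  Real.rpow_lt_rpow_of_exponent_gt (by norm_num) (by norm_num) h

lemma t_der {q : ℕ} {a} {C : ℝ} (hC : 0 ≤ C) (H : DB q a C) {δ : ℝ} (hδ0 : 0 < δ)
    {K : ℝ} (hK : 0 ≤ K) (ψ : Fn d)
    (h1 : ∀ s : NNReal, AEB a (K * (s:ℝ) ^ (δ / 2)) (dl (tv s) ψ)) (s : NNReal) (hs : 0 < s)
    {t : ℝ} (ht : t < 0) (x : EuclideanSpace ℝ (Fin d)) :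
    |ψ.ft t x| ≤ (dl (tv s) ψ).nrm / s +
      C * (1/2) ^ (1 + δ / 2) / (1 / 2 - (1/2) ^ (1 + δ / 2)) * K * s ^ (δ / 2) := by
  have hs' : (0:ℝ) < s := hs
  set b : ℝ := (1/2) ^ (1 + δ / 2) with hb
  have hb0 : 0 < b := by positivity
  have hb1 : b < 1 / 2 := by
    have := half_rpow_lt (β := 1 + δ / 2) (γ := 1) (by linarith)
    rwa [Real.rpow_one] at this
  have hD := down_iter (D := fun j => (dl (tv ((1/2) ^ j * s)) ψ).nrm) (θ := 1 / 2) (b := b)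
    (G := C * K * s ^ (1 + δ / 2) * b) hb0.le hb1 (by positivity) (by
      intro j
      set σ : NNReal := (1/2) ^ (j + 1) * s with hσd
      have hσ : (0:ℝ) < σ := by
        have : 0 < σ := by positivity
        exact this
      have hsq : Real.sqrt σ ^ 2 = σ := Real.sq_sqrt hσ.le
      have := H ψ (Real.sqrt σ) (K * (σ:ℝ) ^ (δ / 2)) (Real.sqrt_pos.2 hσ) (by positivity) (tv σ)
        Xp_zero (by rw [hsq]; rfl) (by simp [tv]) (h1 σ)
      have e : 2 * σ = (1/2) ^ j * s := by
        rw [hσd, pow_succ, ← mul_assoc, mul_comm 2, mul_assoc ((1/2:NNReal)^j)]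
        norm_num
      rw [two_tv, e, hsq] at this
      refine this.trans_eq ?_
      have e2 : C * (K * (σ:ℝ) ^ (δ / 2)) * σ = C * K * (σ:ℝ) ^ (1 + δ / 2) := by
        rw [Real.rpow_add hσ, Real.rpow_one]; ring
      have e3 : (σ:ℝ) ^ (1 + δ / 2) = b ^ (j + 1) * s ^ (1 + δ / 2) := by
        rw [hσd]; push_cast
        rw [rpow_pow_mul _ _ (by norm_num) _ hs'.le]
      rw [e2, e3]
      ring)
  simp only [pow_zero, one_mul] at hD
  have hder : HasDerivAt (fun σ => ψ.f (t - σ) x) (-ψ.ft t x) 0 := by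
    have h0 : HasDerivAt (fun s => ψ.f s x) (ψ.ft t x) (t - 0) := by simpa using ψ.hft t ht x
    exact h0.comp_const_sub t 0
  have := deriv_bound hder hs' (e := fun _ => 0) tendsto_const_nhds (B :=
    ((dl (tv s) ψ).nrm + C * K * s ^ (1 + δ / 2) * b / (1 / 2 - b)) / s) (by
      intro k
      have e1 := le_nrm (dl (tv ((1/2) ^ k * s)) ψ) ht x
      rw [dl_f] at e1
      simp only [tv, add_zero] at e1
      push_cast at e1
      rw [sub_zero, abs_sub_comm, add_zero]
      refine (e1.trans (hD k)).trans_eq ?_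
      field_simp)
  rw [abs_neg] at this
  refine this.trans_eq ?_
  rw [Real.rpow_add hs', Real.rpow_one]
  have : 1 / 2 - b ≠ 0 := by linarith
  field_simp

lemma x_der {q : ℕ} {a} {C : ℝ} (hC : 0 ≤ C) (H : DB q a C) {δ : ℝ} (hδ0 : 0 < δ)
    {K : ℝ} (hK : 0 ≤ K) (ψ : Fn d) (e : EuclideanSpace ℝ (Fin d)) (he : Xp q e) (he1 : ‖e‖ = 1)
    (h1 : ∀ s : ℝ, 0 < s → AEB a (K * s ^ δ) (dl (xv (s • e)) ψ)) (s : ℝ) (hs : 0 < s)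
    {t : ℝ} (ht : t < 0) (x : EuclideanSpace ℝ (Fin d)) :
    |ψ.D1 t x e| ≤ (dl (xv (s • e)) ψ).nrm / s +
      C * (1/2) ^ (2 + δ) / (1 / 2 - (1/2) ^ (2 + δ)) * K * s ^ (1 + δ) := by
  set b : ℝ := (1/2) ^ (2 + δ) with hb
  have hb0 : 0 < b := by positivity
  have hb1 : b < 1 / 2 := by
    have := half_rpow_lt (β := 2 + δ) (γ := 1) (by linarith)
    rwa [Real.rpow_one] at this
  have hD := down_iter (D := fun j : ℕ => (dl (xv (((1/2) ^ j * s) • e)) ψ).nrm) (θ := 1 / 2)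
    (b := b) (G := C * K * s ^ (2 + δ) * b) hb0.le hb1 (by positivity) (by
      intro j
      set σ : ℝ := (1/2) ^ (j + 1) * s with hσd
      have hσ : (0:ℝ) < σ := by positivity
      have := H ψ σ (K * σ ^ δ) hσ (by positivity) (xv (σ • e))
        (he.smul _) (by change ((0:NNReal):ℝ) ≤ _; simp; positivity)
        (by change ‖σ • e‖ ≤ σ; rw [norm_smul, he1, mul_one, Real.norm_of_nonneg hσ.le]) (h1 σ hσ)
      have e1 : 2 * σ = (1/2) ^ j * s := by
        rw [hσd, pow_succ]; ring
      rw [two_xv, smul_smul, e1] at this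
      refine this.trans_eq ?_
      have e2 : C * (K * σ ^ δ) * σ ^ 2 = C * K * σ ^ (2 + δ) := by
        rw [Real.rpow_add hσ]; norm_cast; ring
      have e3 : σ ^ (2 + δ) = b ^ (j + 1) * s ^ (2 + δ) := by
        rw [hσd, rpow_pow_mul _ _ (by norm_num) _ hs.le]
      rw [e2, e3]
      ring)
  simp only [pow_zero, one_mul] at hD
  have hder : HasDerivAt (fun σ : ℝ => ψ.f t (x + σ • e)) (ψ.D1 t x e) 0 := by
    have h0 : HasFDerivAt (ψ.f t) (ψ.D1 t x) (x + (0:ℝ) • e) := by simpa using ψ.hD1 t ht x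
    have h2 : HasDerivAt (fun σ : ℝ => x + σ • e) e 0 := by
      simpa using ((hasDerivAt_id (0:ℝ)).smul_const e).const_add x
    exact h0.comp_hasDerivAt 0 h2
  have := deriv_bound hder hs (e := fun _ => 0) tendsto_const_nhds (B :=
    ((dl (xv (s • e)) ψ).nrm + C * K * s ^ (2 + δ) * b / (1 / 2 - b)) / s) (by
      intro k
      have e1 := le_nrm (dl (xv (((1/2) ^ k * s) • e)) ψ) ht x
      rw [dl_f] at e1
      simp only [xv, NNReal.coe_zero, sub_zero] at e1
      rw [zero_smul, add_zero, abs_sub_comm, add_zero]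
      refine (e1.trans (hD k)).trans_eq ?_
      field_simp)
  refine this.trans_eq ?_
  rw [show 2 + δ = 1 + (1 + δ) by ring, Real.rpow_add hs, Real.rpow_one]
  have : 1 / 2 - b ≠ 0 := by linarith
  field_simp

lemma xx_der {q : ℕ} {a} (ha : CInv d q a) {C : ℝ} (hC : 0 ≤ C) (H : DB q a C) {δ : ℝ} (hδ0 : 0 < δ)
    {K : ℝ} (hK : 0 ≤ K) (ψ : Fn d) (e e' : EuclideanSpace ℝ (Fin d)) (he : Xp q e) (he1 : ‖e‖ = 1)
    (he' : Xp q e') (he1' : ‖e'‖ = 1)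
    (h1 : ∀ s : ℝ, 0 < s → AEB a (K * s ^ δ) (dl (xv (s • e')) ψ)) (s : ℝ) (hs : 0 < s)
    {t : ℝ} (ht : t < 0) (x : EuclideanSpace ℝ (Fin d)) :
    |ψ.D2 t x e e'| ≤ (dl (xv (s • e)) (dl (xv (s • e')) ψ)).nrm / s ^ 2 +
      3 * C * (1/2) ^ (2 + δ) / (1 / 4 - (1/2) ^ (2 + δ)) * K * s ^ δ := by
  set b : ℝ := (1/2) ^ (2 + δ) with hb
  have hb0 : 0 < b := by positivity
  have hb1 : b < 1 / 4 := by
    have := half_rpow_lt (β := 2 + δ) (γ := (2:ℕ)) (by push_cast; linarith)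
    rw [Real.rpow_natCast] at this
    norm_num at this ⊢
    exact this
  have hD := down_iter (D := fun j : ℕ => (dl (xv (((1/2) ^ j * s) • e))
      (dl (xv (((1/2) ^ j * s) • e')) ψ)).nrm) (θ := 1 / 4)
    (b := b) (G := 3 * C * K * s ^ (2 + δ) * b) hb0.le hb1 (by positivity) (by
      intro j
      set σ : ℝ := (1/2) ^ (j + 1) * s with hσd
      have hσ : (0:ℝ) < σ := by positivity
      have := DB2 H ψ (r := σ) (κ := 2 * (K * σ ^ δ)) hσ (by positivity) (xv (σ • e)) (xv (σ • e'))
        (he.smul _) (he'.smul _) (by change ((0:NNReal):ℝ) ≤ _; simp; positivity)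
        (by change ‖σ • e‖ ≤ σ; rw [norm_smul, he1, mul_one, Real.norm_of_nonneg hσ.le])
        (by change ((0:NNReal):ℝ) ≤ _; simp; positivity)
        (by change ‖σ • e'‖ ≤ σ; rw [norm_smul, he1', mul_one, Real.norm_of_nonneg hσ.le])
        ((h1 σ hσ).dl ha _ (he.smul _))
        ((h1 σ hσ).dl ha _ (by rw [two_xv]; exact (he.smul _).smul _))
      have e1 : 2 * σ = (1/2) ^ j * s := by
        rw [hσd, pow_succ]; ring
      rw [two_xv, two_xv, smul_smul, smul_smul, e1] at this
      refine this.trans_eq ?_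
      have e2 : C * (2 * (K * σ ^ δ)) * σ ^ 2 = 2 * C * K * σ ^ (2 + δ) := by
        rw [Real.rpow_add hσ]; norm_cast; ring
      have e3 : σ ^ (2 + δ) = b ^ (j + 1) * s ^ (2 + δ) := by
        rw [hσd, rpow_pow_mul _ _ (by norm_num) _ hs.le]
      rw [e2, e3]
      ring)
  simp only [pow_zero, one_mul] at hD
  have hder : HasDerivAt (fun σ : ℝ => ψ.D1 t (x + σ • e) e') (ψ.D2 t x e e') 0 := by
    have h0 : HasFDerivAt (ψ.D1 t) (ψ.D2 t x) (x + (0:ℝ) • e) := by simpa using ψ.hD2 t ht x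
    have h2 : HasDerivAt (fun σ : ℝ => x + σ • e) e 0 := by
      simpa using ((hasDerivAt_id (0:ℝ)).smul_const e).const_add x
    have h3 := h0.comp_hasDerivAt 0 h2
    exact (ContinuousLinearMap.apply ℝ ℝ e').hasFDerivAt.comp_hasDerivAt 0 h3
  set C' : ℝ := C * b / (1 / 2 - b) * (2 * K) with hC'
  have hlim : Tendsto (fun k : ℕ => C' * ((1/2) ^ k * s) ^ δ) atTop (nhds 0) := by
    have q1 : ∀ k : ℕ, C' * ((1/2) ^ k * s) ^ δ = ((1/2 : ℝ) ^ δ) ^ k * (s ^ δ * C') := fun k => by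
      rw [rpow_pow_mul _ _ (by norm_num) _ hs.le]; ring
    simp_rw [q1]
    have q2 : (1/2 : ℝ) ^ δ < 1 := Real.rpow_lt_one (by norm_num) (by norm_num) hδ0
    have := (tendsto_pow_atTop_nhds_zero_of_lt_one (r := (1/2:ℝ) ^ δ) (by positivity) q2).mul_const
      (s ^ δ * C')
    rwa [zero_mul] at this
  have := deriv_bound hder hs hlim (B :=
    ((dl (xv (s • e)) (dl (xv (s • e')) ψ)).nrm + 3 * C * K * s ^ (2 + δ) * b / (1 / 4 - b)) / s ^ 2)
    (by
      intro k
      set σ : ℝ := (1/2) ^ k * s with hσd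
      have hσ : 0 < σ := by positivity
      have e1 := x_der hC H hδ0 (K := 2 * K) (by positivity) (dl (xv (σ • e)) ψ) e' he' he1'
        (fun ρ hρ => by
          rw [dl_comm]
          refine ((h1 ρ hρ).dl ha _ (he.smul _)).mono ?_
          rw [mul_assoc]) σ hσ ht x
      rw [dl_D1, dl_comm] at e1
      simp only [xv, NNReal.coe_zero, sub_zero, FunLike.coe_sub, Pi.sub_apply] at e1
      rw [zero_smul, add_zero, abs_sub_comm]
      refine e1.trans ?_
      have e2 := div_le_div_of_nonneg_right (hD k) hσ.le
      rw [mul_add]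
      refine add_le_add (e2.trans_eq ?_) (le_of_eq ?_)
      · have e4 : ((1:ℝ)/4) ^ k = (1/2) ^ k * (1/2) ^ k := by rw [← mul_pow]; norm_num
        rw [hσd, e4]
        field_simp
      · rw [hC', Real.rpow_add hσ, Real.rpow_one]; ring)
  refine this.trans_eq ?_
  rw [Real.rpow_add hs]
  have : 1 / 4 - b ≠ 0 := by linarith
  norm_cast
  field_simp

end Fn

/-! ### Conclusion -/

/-- time second-difference constant -/
def cT1 (C δ : ℝ) : ℝ := 3 * C / (1 - 1 / 4 * 2 ^ (1 + δ / 2))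
/-- mixed difference constant -/
def cT2 (C δ : ℝ) : ℝ := 14 * C / (1 - 1 / 8 * 2 ^ (2 + δ))
/-- third space difference constant -/
def cT3 (C δ : ℝ) : ℝ := 7 * C / (1 - 1 / 8 * 2 ^ (2 + δ))
/-- time derivative constant -/
def cB1 (C δ : ℝ) : ℝ := C * (1/2) ^ (1 + δ / 2) / (1 / 2 - (1/2) ^ (1 + δ / 2))
/-- second space derivative constant -/
def cB2 (C δ : ℝ) : ℝ := 3 * C * (1/2) ^ (2 + δ) / (1 / 4 - (1/2) ^ (2 + δ))

lemma consts_nonneg {C δ : ℝ} (hC : 0 ≤ C) (hδ0 : 0 < δ) (hδ1 : δ < 1) :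
    0 ≤ cT1 C δ ∧ 0 ≤ cT2 C δ ∧ 0 ≤ cT3 C δ ∧ 0 ≤ cB1 C δ ∧ 0 ≤ cB2 C δ := by
  have h8 := Fn.pow_two_add_lt hδ1
  have h2 : (2:ℝ) ^ (1 + δ / 2) < 4 := by
    calc (2:ℝ) ^ (1 + δ / 2) < 2 ^ (2:ℝ) := Real.rpow_lt_rpow_of_exponent_lt (by norm_num) (by linarith)
      _ = 4 := by norm_num
  have hb1 : (1/2:ℝ) ^ (1 + δ / 2) < 1 / 2 := by
    have := Fn.half_rpow_lt (β := 1 + δ / 2) (γ := 1) (by linarith)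
    rwa [Real.rpow_one] at this
  have hb2 : (1/2:ℝ) ^ (2 + δ) < 1 / 4 := by
    have := Fn.half_rpow_lt (β := 2 + δ) (γ := (2:ℕ)) (by push_cast; linarith)
    rw [Real.rpow_natCast] at this
    norm_num at this ⊢
    exact this
  refine ⟨?_, ?_, ?_, ?_, ?_⟩
  · exact div_nonneg (by positivity) (by linarith)
  · exact div_nonneg (by positivity) (by linarith)
  · exact div_nonneg (by positivity) (by linarith)
  · exact div_nonneg (by positivity) (by linarith)
  · exact div_nonneg (by positivity) (by linarith)

namespace Fn
variable {d : ℕ}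

lemma est_tt {q : ℕ} {a} (ha : CInv d q a) {C : ℝ} (hC : 0 ≤ C) (H : DB q a C) {δ : ℝ}
    (hδ0 : 0 < δ) (hδ1 : δ < 1) {K : ℝ} (hK : 0 ≤ K) (u : Fn d)
    (h1 : ∀ s : NNReal, AEB a (K * (s:ℝ) ^ (δ / 2)) (dl (tv s) u)) (s : NNReal) (hs : 0 < s)
    {t : ℝ} (ht : t < 0) (x : EuclideanSpace ℝ (Fin d)) :
    |u.ft t x - u.ft (t - s) x| ≤ (cT1 C δ + 2 * cB1 C δ) * K * s ^ (δ / 2) := by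
  have hs' : (0:ℝ) < s := hs
  have e1 := t_der hC H hδ0 (K := 2 * K) (by positivity) (dl (tv s) u) (fun σ => by
    rw [dl_comm]
    refine ((h1 σ).dl ha _ Xp_zero).mono ?_
    rw [mul_assoc]) s hs ht x
  have e2 := tt_est ha hC H hδ0 hδ1 hK u h1 s hs
  rw [dl_ft] at e1
  simp only [tv, add_zero] at e1
  refine e1.trans ?_
  have e3 := div_le_div_of_nonneg_right e2 hs'.le
  have e4 : 3 * C / (1 - 1 / 4 * 2 ^ (1 + δ / 2)) * K * (s:ℝ) ^ (1 + δ / 2) / s =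
      cT1 C δ * K * s ^ (δ / 2) := by
    rw [Real.rpow_add hs', Real.rpow_one, cT1]; field_simp
  rw [e4] at e3
  refine (add_le_add_left e3 _).trans_eq ?_
  rw [cB1]; ring

lemma est_tx {q : ℕ} {a} (ha : CInv d q a) {C : ℝ} (hC : 0 ≤ C) (H : DB q a C) {δ : ℝ}
    (hδ0 : 0 < δ) (hδ1 : δ < 1) {K₁ K₂ : ℝ} (hK₁ : 0 ≤ K₁) (hK₂ : 0 ≤ K₂) (u : Fn d)
    (h1 : ∀ s : NNReal, AEB a (K₁ * (s:ℝ) ^ (δ / 2)) (dl (tv s) u))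
    (h2 : ∀ h, Xp q h → AEB a (K₂ * ‖h‖ ^ δ) (dl (xv h) u))
    (h : EuclideanSpace ℝ (Fin d)) (hh : Xp q h) (hh0 : 0 < ‖h‖)
    {t : ℝ} (ht : t < 0) (x : EuclideanSpace ℝ (Fin d)) :
    |u.ft t x - u.ft t (x + h)| ≤ (cT2 C δ * K₂ + 2 * cB1 C δ * K₁) * ‖h‖ ^ δ := by
  set ρ := ‖h‖ with hρ
  set s : NNReal := ⟨ρ ^ 2, by positivity⟩ with hsd
  have hss : (s:ℝ) = ρ ^ 2 := rfl
  have hs' : (0:ℝ) < s := by rw [hss]; positivity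
  have e1 := t_der hC H hδ0 (K := 2 * K₁) (by positivity) (dl (xv h) u) (fun σ => by
    rw [dl_comm]
    refine ((h1 σ).dl ha _ hh).mono ?_
    rw [mul_assoc]) s hs' ht x
  have e2 := tx_est ha hC H hδ0 hδ1 hK₂ u h2 s h hh hh0 hss.le le_rfl
  rw [dl_ft] at e1
  simp only [xv, NNReal.coe_zero, sub_zero] at e1
  refine e1.trans ?_
  have e3 := div_le_div_of_nonneg_right e2 hs'.le
  have e5 : (s:ℝ) ^ (δ / 2) = ρ ^ δ := by
    rw [hss, ← Real.rpow_natCast, ← Real.rpow_mul hh0.le]; congr 1; push_cast; ring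
  have e4 : 14 * C / (1 - 1 / 8 * 2 ^ (2 + δ)) * K₂ * ρ ^ (2 + δ) / (s:ℝ) =
      cT2 C δ * K₂ * ρ ^ δ := by
    rw [Real.rpow_add hh0, cT2, hss]; norm_cast; field_simp
  rw [e4] at e3
  refine (add_le_add_left e3 _).trans_eq ?_
  rw [cB1, e5]; ring

lemma est_xx {q : ℕ} {a} (ha : CInv d q a) {C : ℝ} (hC : 0 ≤ C) (H : DB q a C) {δ : ℝ}
    (hδ0 : 0 < δ) (hδ1 : δ < 1) {K : ℝ} (hK : 0 ≤ K) (u : Fn d)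
    (h2 : ∀ h, Xp q h → AEB a (K * ‖h‖ ^ δ) (dl (xv h) u))
    (e e' : EuclideanSpace ℝ (Fin d)) (he : Xp q e) (he1 : ‖e‖ = 1)
    (he' : Xp q e') (he1' : ‖e'‖ = 1)
    (h : EuclideanSpace ℝ (Fin d)) (hh : Xp q h) (hh0 : 0 < ‖h‖)
    {t : ℝ} (ht : t < 0) (x : EuclideanSpace ℝ (Fin d)) :
    |u.D2 t x e e' - u.D2 t (x + h) e e'| ≤ (cT3 C δ + 2 * cB2 C δ) * K * ‖h‖ ^ δ := by
  set ρ := ‖h‖ with hρ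
  have e1 := xx_der ha hC H hδ0 (K := 2 * K) (by positivity) (dl (xv h) u) e e' he he1 he' he1'
    (fun σ hσ => by
      rw [dl_comm]
      refine ((h2 _ (he'.smul σ)).dl ha _ hh).mono ?_
      rw [norm_smul, he1', Real.norm_of_nonneg hσ.le, mul_one, mul_assoc]) ρ hh0 ht x
  have hn : ∀ v : EuclideanSpace ℝ (Fin d), ‖v‖ = 1 → ‖ρ • v‖ ≤ ρ := fun v hv => by
    rw [norm_smul, hv, mul_one, Real.norm_of_nonneg hh0.le]
  have e2 := xxx_est ha hC H hδ0 hδ1 hK u h2 (ρ • e) (ρ • e') h (he.smul _) (he'.smul _) hh hh0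
    (hn e he1) (hn e' he1') le_rfl
  rw [dl_D2] at e1
  simp only [xv, NNReal.coe_zero, sub_zero, FunLike.coe_sub, Pi.sub_apply] at e1
  refine e1.trans ?_
  have e3 := div_le_div_of_nonneg_right e2 (by positivity : 0 ≤ ρ ^ 2)
  have e4 : 7 * C / (1 - 1 / 8 * 2 ^ (2 + δ)) * K * ρ ^ (2 + δ) / ρ ^ 2 =
      cT3 C δ * K * ρ ^ δ := by
    rw [Real.rpow_add hh0, cT3]; norm_cast; field_simp
  rw [e4] at e3
  refine (add_le_add_left e3 _).trans_eq ?_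
  rw [cB2]; ring

lemma est_xt {q : ℕ} {a} (ha : CInv d q a) {C : ℝ} (hC : 0 ≤ C) (H : DB q a C) {δ : ℝ}
    (hδ0 : 0 < δ) (hδ1 : δ < 1) {K : ℝ} (hK : 0 ≤ K) (u : Fn d)
    (h2 : ∀ h, Xp q h → AEB a (K * ‖h‖ ^ δ) (dl (xv h) u))
    (e e' : EuclideanSpace ℝ (Fin d)) (he : Xp q e) (he1 : ‖e‖ = 1)
    (he' : Xp q e') (he1' : ‖e'‖ = 1) (s : NNReal) (hs : 0 < s)
    {t : ℝ} (ht : t < 0) (x : EuclideanSpace ℝ (Fin d)) :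
    |u.D2 t x e e' - u.D2 (t - s) x e e'| ≤ (2 * cT2 C δ + 2 * cB2 C δ) * K * s ^ (δ / 2) := by
  have hs' : (0:ℝ) < s := hs
  set ρ := Real.sqrt s with hρ
  have hh0 : 0 < ρ := Real.sqrt_pos.2 hs'
  have hsq : ρ ^ 2 = s := Real.sq_sqrt hs'.le
  have e1 := xx_der ha hC H hδ0 (K := 2 * K) (by positivity) (dl (tv s) u) e e' he he1 he' he1'
    (fun σ hσ => by
      rw [dl_comm]
      refine ((h2 _ (he'.smul σ)).dl ha _ Xp_zero).mono ?_
      rw [norm_smul, he1', Real.norm_of_nonneg hσ.le, mul_one, mul_assoc]) ρ hh0 ht x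
  have e2 := tx_est ha hC H hδ0 hδ1 hK u h2 s (ρ • e') (he'.smul _) hh0 hsq.ge (by
    rw [norm_smul, he1', mul_one, Real.norm_of_nonneg hh0.le])
  have e2' := nrm_dl_le (xv (ρ • e)) (dl (xv (ρ • e')) (dl (tv s) u))
  rw [dl_comm (tv s)] at e2
  rw [dl_D2] at e1
  simp only [tv, add_zero, FunLike.coe_sub, Pi.sub_apply] at e1
  refine e1.trans ?_
  have e3 := div_le_div_of_nonneg_right (e2'.trans (mul_le_mul_of_nonneg_left e2 zero_le_two))
    (by positivity : 0 ≤ ρ ^ 2)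
  have e4 : 2 * (14 * C / (1 - 1 / 8 * 2 ^ (2 + δ)) * K * ρ ^ (2 + δ)) / ρ ^ 2 =
      2 * cT2 C δ * K * ρ ^ δ := by
    rw [Real.rpow_add hh0, cT2]; norm_cast; field_simp
  have e5 : (s:ℝ) ^ (δ / 2) = ρ ^ δ := by
    rw [← hsq, ← Real.rpow_natCast, ← Real.rpow_mul hh0.le]; congr 1; push_cast; ring
  rw [e4] at e3
  refine (add_le_add_left e3 _).trans_eq ?_
  rw [cB2, e5]; ring

lemma clm1_expand (L : EuclideanSpace ℝ (Fin d) →L[ℝ] ℝ) :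
    L = ∑ i, L (EuclideanSpace.single i 1) • (EuclideanSpace.proj i : EuclideanSpace ℝ (Fin d) →L[ℝ] ℝ) := by
  apply ContinuousLinearMap.ext
  intro y
  conv_lhs => rw [eucl_sum_single y]
  simp [mul_comm]

lemma clm2_expand (L : EuclideanSpace ℝ (Fin d) →L[ℝ] EuclideanSpace ℝ (Fin d) →L[ℝ] ℝ) :
    L = ∑ i, ∑ j, L (EuclideanSpace.single i 1) (EuclideanSpace.single j 1) •
      (EuclideanSpace.proj i : EuclideanSpace ℝ (Fin d) →L[ℝ] ℝ).smulRight
        (EuclideanSpace.proj j : EuclideanSpace ℝ (Fin d) →L[ℝ] ℝ) := by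
  apply ContinuousLinearMap.ext
  intro y
  apply ContinuousLinearMap.ext
  intro w
  conv_lhs => rw [eucl_sum_single y, eucl_sum_single w]
  simp [Finset.mul_sum]
  rw [Finset.sum_comm]
  refine Finset.sum_congr rfl fun i _ => Finset.sum_congr rfl fun j _ => ?_
  ring

lemma sd2_eq {v : EuclideanSpace ℝ (Fin d) → ℝ} {x : EuclideanSpace ℝ (Fin d)}
    (h : ContDiffAt ℝ 2 v x) (i j : Fin d) :
    sd2 i j v x = fderiv ℝ (fderiv ℝ v) x (EuclideanSpace.single i 1) (EuclideanSpace.single j 1) := by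
  have h1 : DifferentiableAt ℝ (fderiv ℝ v) x :=
    (h.fderiv_right (m := 1) (by norm_num)).differentiableAt (by norm_num)
  have h2 : HasFDerivAt (fun y => fderiv ℝ v y (EuclideanSpace.single j 1)) _ x :=
    (ContinuousLinearMap.apply ℝ ℝ (EuclideanSpace.single j (1:ℝ))).hasFDerivAt.comp x
      h1.hasFDerivAt
  unfold sd2 sd
  rw [h2.fderiv]
  simp

/-- A bounded classical function as an element of `Fn`. -/
def ofClassical (u : ℝ → EuclideanSpace ℝ (Fin d) → ℝ) (hu : ParClassical (parNeg d) u)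
    (hb : ∃ M : ℝ, ∀ z ∈ parNeg d, |u z.1 z.2| ≤ M) : Fn d where
  f := u
  ft := td u
  D1 := fun t x => fderiv ℝ (u t) x
  D2 := fun t x => fderiv ℝ (fderiv ℝ (u t)) x
  hft := fun t ht x => (hu.1 (t, x) ⟨ht, mem_univ _⟩).hasDerivAt
  hD1 := fun t ht x =>
    ((hu.2.1 (t, x) ⟨ht, mem_univ _⟩).differentiableAt (by norm_num)).hasFDerivAt
  hD2 := fun t ht x => (((hu.2.1 (t, x) ⟨ht, mem_univ _⟩).fderiv_right (m := 1)
    (by norm_num)).differentiableAt (by norm_num)).hasFDerivAt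
  cf := hu.2.2.1
  cft := hu.2.2.2.1
  cD1 := by
    have h1 : (fun z : ℝ × EuclideanSpace ℝ (Fin d) => fderiv ℝ (u z.1) z.2) = fun z =>
        ∑ i, sd i (u z.1) z.2 • (EuclideanSpace.proj i : EuclideanSpace ℝ (Fin d) →L[ℝ] ℝ) := by
      funext z
      exact clm1_expand _
    rw [h1]
    exact continuousOn_finset_sum _ fun i _ => (hu.2.2.2.2.1 i).smul continuousOn_const
  cD2 := by
    have h1 : EqOn (fun z : ℝ × EuclideanSpace ℝ (Fin d) => fderiv ℝ (fderiv ℝ (u z.1)) z.2)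
        (fun z => ∑ i, ∑ j, sd2 i j (u z.1) z.2 •
      (EuclideanSpace.proj i : EuclideanSpace ℝ (Fin d) →L[ℝ] ℝ).smulRight
        (EuclideanSpace.proj j : EuclideanSpace ℝ (Fin d) →L[ℝ] ℝ)) (parNeg d) := by
      intro z hz
      simp only
      rw [clm2_expand (fderiv ℝ (fderiv ℝ (u z.1)) z.2)]
      refine Finset.sum_congr rfl fun i _ => Finset.sum_congr rfl fun j _ => ?_
      rw [sd2_eq (hu.2.1 z hz)]
    refine ContinuousOn.congr ?_ h1
    exact continuousOn_finset_sum _ fun i _ => continuousOn_finset_sum _ fun j _ =>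
      (hu.2.2.2.2.2 i j).smul continuousOn_const
  bdd := by
    obtain ⟨M, hM⟩ := hb
    exact ⟨M, fun t ht x => hM (t, x) ⟨ht, mem_univ _⟩⟩

lemma AEB_of_f {q : ℕ} {a} (ha : CInv d q a) (U : Fn d) (f : ℝ → EuclideanSpace ℝ (Fin d) → ℝ)
    (h : ∀ᵐ z ∂((volume : Measure (ℝ × EuclideanSpace ℝ (Fin d))).restrict (parNeg d)),
      Lop a U z.1 z.2 = f z.1 z.2) (τ : Vec d) (hτ : Xp q τ.2) (κ : ℝ)
    (hf : ∀ t < 0, ∀ x, |f t x - f (t - τ.1) (x + τ.2)| ≤ κ) : AEB a κ (dl τ U) := by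
  filter_upwards [h, ae_parNeg_shift τ h, ae_restrict_mem (parNeg_open d).measurableSet] with z h1 h2 hz
  rw [dl, Lop_lin, Lop_shift ha τ hτ, h1, h2]
  have := hf z.1 hz.1 z.2
  rwa [one_mul, neg_one_mul, ← sub_eq_add_neg]

lemma holderT_of {γ N K : ℝ} {g : ℝ → EuclideanSpace ℝ (Fin d) → ℝ} (hγ : 0 < γ)
    (h : ∀ s : NNReal, 0 < s → ∀ t < 0, ∀ x, |g t x - g (t - s) x| ≤ N * K * (s:ℝ) ^ γ) :
    HolderTPar d γ (parNeg d) g (N * K) := by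
  intro t s x ht hs
  rcases lt_trichotomy t s with hlt | rfl | hlt
  · have := h ⟨s - t, by linarith⟩ (by change (0:ℝ) < s - t; linarith) s hs.1 x
    change |g s x - g (s - (s - t)) x| ≤ N * K * (s - t) ^ γ at this
    rw [sub_sub_cancel] at this
    rw [abs_sub_comm, abs_sub_comm t s, abs_of_pos (by linarith : 0 < s - t)]
    exact this
  · simp [Real.zero_rpow hγ.ne']
  · have := h ⟨t - s, by linarith⟩ (by change (0:ℝ) < t - s; linarith) t ht.1 x
    change |g t x - g (t - (t - s)) x| ≤ N * K * (t - s) ^ γ at this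
    rw [sub_sub_cancel] at this
    rw [abs_of_pos (by linarith : 0 < t - s)]
    exact this

lemma holderX_of {q : ℕ} {δ N K : ℝ} {g : ℝ → EuclideanSpace ℝ (Fin d) → ℝ} (hδ : 0 < δ)
    (h : ∀ h : EuclideanSpace ℝ (Fin d), Xp q h → 0 < ‖h‖ → ∀ t < 0, ∀ x,
      |g t x - g t (x + h)| ≤ N * K * ‖h‖ ^ δ) :
    PHolderXPar d q δ (parNeg d) g (N * K) := by
  intro t x y ht _ hxy
  by_cases hne : x = y
  · subst hne
    simp [Real.zero_rpow hδ.ne']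
  · have := h (y - x) (fun k hk => by simp [hxy k hk]) (norm_pos_iff.2 (sub_ne_zero.2 (Ne.symm hne)))
      t ht.1 x
    rwa [add_sub_cancel, ← dist_eq_norm, dist_comm] at this

end Fn

/-- **Corollary 4.2**: partial Schauder estimate in `z' = (t, x')` on `(-∞,0) × ℝ^d` for
non-divergence form parabolic equations with coefficients independent of `z'`. -/
theorem partial_schauder_parabolic_wholespace_tz
    (d q : ℕ) (ν δ : ℝ) (hd : 2 ≤ d) (hq1 : 1 ≤ q) (hqd : q < d)
    (hν : ν ∈ Ioc (0 : ℝ) 1) (hδ : δ ∈ Ioo (0 : ℝ) 1) :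
    ∃ N : ℝ, 0 < N ∧
      ∀ (a : Fin d → Fin d → ℝ → EuclideanSpace ℝ (Fin d) → ℝ)
        (u f : ℝ → EuclideanSpace ℝ (Fin d) → ℝ),
        (∀ i j, Measurable (fun z : ℝ × EuclideanSpace ℝ (Fin d) => a i j z.1 z.2)) →
        (∀ i j t x, a i j t x = a j i t x) →
        UnifEllipticP d ν a →
        -- coefficients independent of `z' = (t, x')`
        (∀ i j (t s : ℝ) (x y : EuclideanSpace ℝ (Fin d)),
          (∀ k : Fin d, q ≤ (k : ℕ) → x k = y k) → a i j t x = a i j s y) →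
        ParClassical (parNeg d) u →
        (∃ M : ℝ, ∀ z ∈ parNeg d, |u z.1 z.2| ≤ M) →
        (∀ᵐ z ∂(volume.restrict (parNeg d)),
          td u z.1 z.2 - ∑ i, ∑ j, a i j z.1 z.2 * sd2 i j (u z.1) z.2 = f z.1 z.2) →
        ∀ K₁ K₂ : ℝ, 0 ≤ K₁ → 0 ≤ K₂ →
          HolderTPar d (δ/2) (parNeg d) f K₁ →
          PHolderXPar d q δ (parNeg d) f K₂ →
          HolderTPar d (δ/2) (parNeg d) (td u) (N * (K₁ + K₂)) ∧
          PHolderXPar d q δ (parNeg d) (td u) (N * (K₁ + K₂)) ∧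
          ∀ i j : Fin d, (i : ℕ) < q → (j : ℕ) < q →
            HolderTPar d (δ/2) (parNeg d) (fun t x => sd2 i j (u t) x)
              (N * (K₁ + K₂)) ∧
            PHolderXPar d q δ (parNeg d) (fun t x => sd2 i j (u t) x)
              (N * (K₁ + K₂)) := by
  obtain ⟨C, hC0, hCdb⟩ := Fn.dbl d hν.1
  have hC := hC0.le
  obtain ⟨hδ0, hδ1⟩ := hδ
  obtain ⟨p1, p2, p3, p4, p5⟩ := consts_nonneg hC hδ0 hδ1
  set N := cT1 C δ + 2 * cT2 C δ + cT3 C δ + 2 * cB1 C δ + 2 * cB2 C δ + 1 with hN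
  refine ⟨N, by positivity, ?_⟩
  intro a u f _ _ hell ha hu hb heq K₁ K₂ hK₁ hK₂ hf1 hf2
  have ha' : CInv d q a := ha
  have H : Fn.DB q a C := hCdb q a hell ha'
  set U := Fn.ofClassical u hu hb with hU
  have hsd2 : ∀ i j (t : ℝ), t < 0 → ∀ x, sd2 i j (u t) x =
      U.D2 t x (EuclideanSpace.single i 1) (EuclideanSpace.single j 1) := fun i j t ht x =>
    Fn.sd2_eq (hu.2.1 (t, x) ⟨ht, mem_univ _⟩) i j
  have hLop : ∀ᵐ z ∂((volume : Measure (ℝ × EuclideanSpace ℝ (Fin d))).restrict (parNeg d)),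
      Fn.Lop a U z.1 z.2 = f z.1 z.2 := by
    filter_upwards [heq, ae_restrict_mem (parNeg_open d).measurableSet] with z hz hzn
    rw [← hz, Fn.Lop]
    congr 1
    refine Finset.sum_congr rfl fun i _ => Finset.sum_congr rfl fun j _ => ?_
    rw [hsd2 i j _ hzn.1]
  have h1 : ∀ s : NNReal, Fn.AEB a (K₁ * (s:ℝ) ^ (δ / 2)) (Fn.dl (tv s) U) := by
    intro s
    refine Fn.AEB_of_f ha' U f hLop (tv s) Fn.Xp_zero _ fun t ht x => ?_
    have := hf1 t (t - s) x ⟨ht, mem_univ _⟩ ⟨Fn.shift_lt ht s, mem_univ _⟩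
    rw [sub_sub_cancel, abs_of_nonneg s.coe_nonneg] at this
    simpa only [tv, add_zero] using this
  have h2 : ∀ h, Xp q h → Fn.AEB a (K₂ * ‖h‖ ^ δ) (Fn.dl (xv h) U) := by
    intro h hh
    refine Fn.AEB_of_f ha' U f hLop (xv h) hh _ fun t ht x => ?_
    have := hf2 t x (x + h) ⟨ht, mem_univ _⟩ ⟨ht, mem_univ _⟩ fun k hk => by simp [hh k hk]
    rw [dist_self_add_right] at this
    simpa only [xv, NNReal.coe_zero, sub_zero] using this
  have hXp : ∀ i : Fin d, (i : ℕ) < q → Xp q (EuclideanSpace.single i (1:ℝ)) := by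
    intro i hi k hk
    have : k ≠ i := by rintro rfl; omega
    simp [this]
  have hnorm : ∀ i : Fin d, ‖EuclideanSpace.single i (1:ℝ)‖ = 1 := fun i => by simp
  have hle : ∀ c₁ c₂ : ℝ, c₁ ≤ N → c₂ ≤ N → c₁ * K₁ + c₂ * K₂ ≤ N * (K₁ + K₂) := by
    intro c₁ c₂ q1 q2
    rw [mul_add]
    gcongr
  refine ⟨?_, ?_, ?_⟩
  · refine Fn.holderT_of (by positivity) fun s hs t ht x => ?_
    refine (Fn.est_tt ha' hC H hδ0 hδ1 hK₁ U h1 s hs ht x).trans ?_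
    refine mul_le_mul_of_nonneg_right ?_ (by positivity)
    have := hle (cT1 C δ + 2 * cB1 C δ) 0 (by linarith) (by positivity)
    linarith
  · refine Fn.holderX_of hδ0 fun h hh hh0 t ht x => ?_
    refine (Fn.est_tx ha' hC H hδ0 hδ1 hK₁ hK₂ U h1 h2 h hh hh0 ht x).trans ?_
    refine mul_le_mul_of_nonneg_right ?_ (by positivity)
    have := hle (2 * cB1 C δ) (cT2 C δ) (by linarith) (by linarith)
    linarith
  · intro i j hi hj
    constructor
    · refine Fn.holderT_of (by positivity) fun s hs t ht x => ?_
      rw [hsd2 i j t ht, hsd2 i j _ (Fn.shift_lt ht s)]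
      refine (Fn.est_xt ha' hC H hδ0 hδ1 hK₂ U h2 _ _ (hXp i hi) (hnorm i) (hXp j hj) (hnorm j)
        s hs ht x).trans ?_
      refine mul_le_mul_of_nonneg_right ?_ (by positivity)
      have := hle 0 (2 * cT2 C δ + 2 * cB2 C δ) (by positivity) (by linarith)
      linarith
    · refine Fn.holderX_of hδ0 fun h hh hh0 t ht x => ?_
      rw [hsd2 i j t ht, hsd2 i j t ht]
      refine (Fn.est_xx ha' hC H hδ0 hδ1 hK₂ U h2 _ _ (hXp i hi) (hnorm i) (hXp j hj) (hnorm j)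
        h hh hh0 ht x).trans ?_
      refine mul_le_mul_of_nonneg_right ?_ (by positivity)
      have := hle 0 (cT3 C δ + 2 * cB2 C δ) (by positivity) (by linarith)
      linarith
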